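/- arXiv:2104.13045 — 2 statements merged into one kernel-verified Lean document; each statement's English description precedes it below -/
import Mathlib

section
/- For every dimension d ∈ ℕ, d ≥ 1, there exists a constant M₀ > 0 such that for every multi-index β ∈ ℕ^d and integers k, m ∈ ℕ with |β| + k > 0 and 0 ≤ m ≤ k, for every 1 ≤ q ≤ ∞ and every t > 0, ‖D_x^β ∂_t^k (t^m ∇G(·,t))‖_{L^q(ℝ^d)} ≤ M₀^{|β|/2 + k} (|β|+k)^{(|β|+1)/2 + k + (d/2)(1−1/q)} t^{−(|β|+2(k−m)+1)/2 − (d/2)(1−1/q)}. -/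
open MeasureTheory Real Filter
open scoped ENNReal BigOperators Topology

noncomputable section

abbrev Euc (d : ℕ) : Type := EuclideanSpace ℝ (Fin d)

/-- The heat kernel on `ℝ^d`. -/
noncomputable def heatKernel (d : ℕ) (t : ℝ) (x : Euc d) : ℝ :=
  (4 * Real.pi * t) ^ (-(d : ℝ) / 2) * Real.exp (-‖x‖ ^ 2 / (4 * t))

/-- Partial derivative in the `i`-th coordinate direction. -/
noncomputable def pd {d : ℕ} {F : Type*} [NormedAddCommGroup F] [NormedSpace ℝ F]
    (i : Fin d) (f : Euc d → F) : Euc d → F :=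
  fun x => fderiv ℝ f x (EuclideanSpace.single i 1)

/-- Multi-index spatial derivative `D_x^β`. -/
noncomputable def mderiv {d : ℕ} {F : Type*} [NormedAddCommGroup F] [NormedSpace ℝ F]
    (β : Fin d → ℕ) (f : Euc d → F) : Euc d → F :=
  (List.finRange d).foldr (fun i g => (pd i)^[β i] g) f

/-- `k`-th time derivative (pointwise in space). -/
noncomputable def tderiv {d : ℕ} {F : Type*} [NormedAddCommGroup F] [NormedSpace ℝ F]
    (k : ℕ) (ρ : ℝ → Euc d → F) (t : ℝ) : Euc d → F :=
  fun x => iteratedDeriv k (fun s => ρ s x) t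

/-- Convolution of two scalar functions on `ℝ^d`. -/
noncomputable def conv {d : ℕ} (f g : Euc d → ℝ) : Euc d → ℝ :=
  fun x => ∫ y, f (x - y) * g y

/-- Convolution of a vector field with a scalar function on `ℝ^d`. -/
noncomputable def convV {d : ℕ} (f : Euc d → Euc d) (g : Euc d → ℝ) : Euc d → Euc d :=
  fun x => ∫ y, g y • f (x - y)

/-- Gradient of the heat kernel. -/
noncomputable def gradHeat (d : ℕ) (t : ℝ) : Euc d → Euc d :=
  gradient (fun x => heatKernel d t x)

/-- Gradient of the logarithmic potential `c` generated by `ρ`. -/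
noncomputable def gradc (d : ℕ) (ρ : Euc d → ℝ) (x : Euc d) : Euc d :=
  (-(1 / (d * Real.pi))) • ∫ y, (ρ y / ‖x - y‖ ^ 2) • (x - y)

/-- `|β|` for a multi-index. -/
def msize {d : ℕ} (β : Fin d → ℕ) : ℕ := ∑ i, β i

/-- The exponent `2d/(2d-1)` as an element of `ℝ≥0∞`. -/
noncomputable def qd (d : ℕ) : ℝ≥0∞ := (2 * d : ℝ≥0∞) / (2 * d - 1 : ℝ≥0∞)

/-- Right-hand side of the Duhamel formula for the mPKS equations. -/
noncomputable def mildRHS (d : ℕ) (ρ₀ : Euc d → ℝ) (ρ : ℝ → Euc d → ℝ) (t : ℝ) (x : Euc d) : ℝ :=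
  conv (heatKernel d t) ρ₀ x -
    ∫ s in Set.Ioc (0:ℝ) t,
      ∫ y, (inner ℝ (gradHeat d (t - s) (x - y)) (ρ s y • gradc d (ρ s) y) : ℝ)

/-- Mild solution of the mPKS equations on `[0,T]`. -/
def IsMildSolution (d : ℕ) (ρ₀ : Euc d → ℝ) (T : ℝ) (ρ : ℝ → Euc d → ℝ) : Prop :=
  ∀ t ∈ Set.Ioc (0:ℝ) T, ∀ x, ρ t x = mildRHS d ρ₀ ρ t x

/-- Membership in the space `X_T`. -/
def MemXT (d : ℕ) (T : ℝ) (ρ : ℝ → Euc d → ℝ) : Prop :=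
  (∀ t ∈ Set.Ioc (0:ℝ) T, MemLp (ρ t) 1 volume) ∧
  (∀ t ∈ Set.Ioc (0:ℝ) T,
    Filter.Tendsto (fun s => eLpNorm (fun x => ρ s x - ρ t x) 1 volume)
      (nhdsWithin t (Set.Ioc (0:ℝ) T)) (nhds 0)) ∧
  (∃ C : ℝ≥0∞, C ≠ ⊤ ∧ ∀ t ∈ Set.Ioc (0:ℝ) T, eLpNorm (ρ t) 1 volume ≤ C) ∧
  (∃ C : ℝ≥0∞, C ≠ ⊤ ∧ ∀ t ∈ Set.Ioc (0:ℝ) T,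
    ENNReal.ofReal (t ^ (1/4 : ℝ)) * eLpNorm (ρ t) (qd d) volume ≤ C)

/-- Assumption (𝒜): decay of the heat semigroup applied to `ρ₀`. -/
def AssumptionA (d : ℕ) (ρ₀ : Euc d → ℝ) (T θ : ℝ) : Prop :=
  ∀ q : ℝ≥0∞, 1 ≤ q → ∀ t ∈ Set.Ioc (0:ℝ) T,
    ENNReal.ofReal (t ^ (((d : ℝ) / 2) * (1 - q⁻¹.toReal))) *
      eLpNorm (conv (heatKernel d t) ρ₀) q volume ≤ ENNReal.ofReal θ


/-- Functions of the form (polynomial in `x`) times Gaussian, with scaling exponent `a`,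
degree at most `D` and weighted coefficient size at most `K`. -/
inductive GB {d : ℕ} (R : ℝ) : ℝ → ℕ → ℝ → (ℝ → Euc d → Euc d) → Prop
  | base (b : ℝ) (c : Euc d) :
      GB R b 0 ‖c‖ (fun s x => (s ^ b * Real.exp (-‖x‖ ^ 2 / (4 * s))) • c)
  | coord (a : ℝ) (D : ℕ) (K : ℝ) (f : ℝ → Euc d → Euc d) (j : Fin d) :
      GB R a D K f → GB R (a + 1 / 2) (D + 1) (R * K) (fun s x => x j • f s x)
  | add (a : ℝ) (D : ℕ) (K K' : ℝ) (f g : ℝ → Euc d → Euc d) :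
      GB R a D K f → GB R a D K' g → GB R a D (K + K') (fun s x => f s x + g s x)
  | mono (a : ℝ) (D D' : ℕ) (K K' : ℝ) (f g : ℝ → Euc d → Euc d) :
      GB R a D K f → D ≤ D' → K ≤ K' → (∀ s, 0 < s → ∀ x, g s x = f s x) → GB R a D' K' g

theorem GB.nonneg {d : ℕ} {R a K : ℝ} {D : ℕ} {f : ℝ → Euc d → Euc d} (hR : 0 ≤ R)
    (h : GB R a D K f) : 0 ≤ K := by
  induction h with
  | base b c => exact norm_nonneg c
  | coord a D K f j h ih => exact mul_nonneg hR ih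
  | add a D K K' f g h1 h2 ih1 ih2 => exact add_nonneg ih1 ih2
  | mono a D D' K K' f g h hD hK he ih => exact ih.trans hK

theorem gauss_hasFDerivAt {d : ℕ} (s : ℝ) (x : Euc d) :
    HasFDerivAt (fun x : Euc d => Real.exp (-‖x‖ ^ 2 / (4 * s)))
      ((-(1 / (2 * s)) * Real.exp (-‖x‖ ^ 2 / (4 * s))) • innerSL ℝ x) x := by
  have h1 := (hasStrictFDerivAt_norm_sq x).hasFDerivAt
  have h2 := ((h1.neg).mul_const ((4 * s)⁻¹)).exp
  have h3 : HasFDerivAt (fun x : Euc d => Real.exp (-‖x‖ ^ 2 / (4 * s))) _ x := h2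
  refine h3.congr_fderiv ?_
  ext v
  simp only [_root_.smul_apply, _root_.neg_apply, innerSL_apply_apply,
    smul_eq_mul, nsmul_eq_mul]
  rw [div_eq_mul_inv]
  rcases eq_or_ne s 0 with rfl | hs
  · simp
  · simp
    field_simp
    ring

theorem GB.diffX {d : ℕ} {R a K : ℝ} {D : ℕ} {f : ℝ → Euc d → Euc d}
    (h : GB R a D K f) : ∀ s, 0 < s → Differentiable ℝ (f s) := by
  induction h with
  | base b c =>
    intro s hs x
    exact ((gauss_hasFDerivAt s x).differentiableAt.const_mul _).smul_const c
  | coord a D K f j h ih =>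
    intro s hs
    have : Differentiable ℝ (fun x : Euc d => x j) := by fun_prop
    exact this.smul (ih s hs)
  | add a D K K' f g h1 h2 ih1 ih2 => intro s hs; exact (ih1 s hs).add (ih2 s hs)
  | mono a D D' K K' f g h hD hK he ih =>
    intro s hs
    have : g s = f s := funext (he s hs)
    rw [this]; exact ih s hs

theorem gauss_hasDerivAt {d : ℕ} (b s : ℝ) (hs : 0 < s) (x : Euc d) :
    HasDerivAt (fun s : ℝ => s ^ b * Real.exp (-‖x‖ ^ 2 / (4 * s)))
      (b * (s ^ (b - 1) * Real.exp (-‖x‖ ^ 2 / (4 * s))) +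
        ‖x‖ ^ 2 / 4 * (s ^ (b - 2) * Real.exp (-‖x‖ ^ 2 / (4 * s)))) s := by
  have h1 : HasDerivAt (fun s : ℝ => s ^ b) (b * s ^ (b - 1)) s :=
    Real.hasDerivAt_rpow_const (Or.inl hs.ne')
  have h2 : HasDerivAt (fun s : ℝ => -‖x‖ ^ 2 / (4 * s)) (‖x‖ ^ 2 / (4 * s ^ 2)) s := by
    have := (((hasDerivAt_id s).const_mul (4 : ℝ)).fun_inv (by simp [hs.ne'])).const_mul (-‖x‖ ^ 2)
    refine this.congr_deriv ?_
    simp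
    field_simp
  refine (h1.mul h2.exp).congr_deriv ?_
  have : s ^ (b - 2) = s ^ b / s ^ 2 := by
    rw [Real.rpow_sub hs]; norm_num
  rw [this]
  field_simp

theorem GB.diffT {d : ℕ} {R a K : ℝ} {D : ℕ} {f : ℝ → Euc d → Euc d}
    (h : GB R a D K f) : ∀ s, 0 < s → ∀ x, DifferentiableAt ℝ (fun r => f r x) s := by
  induction h with
  | base b c =>
    intro s hs x
    exact (gauss_hasDerivAt b s hs x).differentiableAt.smul_const c
  | coord a D K f j h ih =>
    intro s hs x
    exact (ih s hs x).const_smul (x j)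
  | add a D K K' f g h1 h2 ih1 ih2 => intro s hs x; exact (ih1 s hs x).add (ih2 s hs x)
  | mono a D D' K K' f g h hD hK he ih =>
    intro s hs x
    refine (ih s hs x).congr_of_eventuallyEq ?_
    filter_upwards [lt_mem_nhds hs] with r hr using he r hr x

theorem GB.smul {d : ℕ} {R a K : ℝ} {D : ℕ} {f : ℝ → Euc d → Euc d}
    (h : GB R a D K f) (r : ℝ) : GB R a D (|r| * K) (fun s x => r • f s x) := by
  induction h with
  | base b c =>
    refine GB.mono _ _ _ _ _ _ _ (GB.base b (r • c)) le_rfl (by rw [norm_smul, Real.norm_eq_abs]) ?_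
    intro s hs x
    exact smul_comm _ _ _
  | coord a D K f j h ih =>
    refine GB.mono _ _ _ _ _ _ _ (GB.coord _ _ _ _ j ih) le_rfl (by rw [mul_left_comm]) ?_
    intro s hs x
    exact smul_comm _ _ _
  | add a D K K' f g h1 h2 ih1 ih2 =>
    refine GB.mono _ _ _ _ _ _ _ (GB.add _ _ _ _ _ _ ih1 ih2) le_rfl (by rw [mul_add]) ?_
    intro s hs x
    exact smul_add _ _ _
  | mono a D D' K K' f g h hD hK he ih =>
    refine GB.mono _ _ _ _ _ _ _ ih hD (by gcongr) ?_
    intro s hs x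
    rw [he s hs x]

theorem GB.sum {d : ℕ} {R a K : ℝ} {D : ℕ} {ι : Type*} (S : Finset ι)
    (f : ι → ℝ → Euc d → Euc d)
    (h : ∀ i, GB R a D K (f i)) : GB R a D (S.card * K) (fun s x => ∑ i ∈ S, f i s x) := by
  classical
  induction S using Finset.induction_on with
  | empty =>
    refine GB.mono _ _ _ _ _ _ _ (GB.base a 0) (Nat.zero_le D) (by simp) ?_
    intro s hs x
    simp
  | insert i S hi ih =>
    refine GB.mono _ _ _ _ _ _ _ (GB.add _ _ _ _ _ _ (h i) ih) le_rfl ?_ ?_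
    · rw [Finset.card_insert_of_notMem hi]; push_cast; linarith
    · intro s hs x
      rw [Finset.sum_insert hi]

theorem GB.pdx {d : ℕ} {R a K : ℝ} {D : ℕ} {f : ℝ → Euc d → Euc d} (hR : 0 < R)
    (h : GB R a D K f) (i : Fin d) :
    GB R (a - 1 / 2) (D + 1) ((D / R + R / 2) * K) (fun s => pd i (f s)) := by
  induction h with
  | base b c =>
    have h1 := (GB.coord _ _ _ _ i (GB.base (R := R) (b - 1) c)).smul (-(1 / 2))
    rw [show b - 1 + 1 / 2 = b - 1 / 2 by ring] at h1
    refine GB.mono _ _ _ _ _ _ _ h1 le_rfl (le_of_eq ?_) ?_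
    · rw [abs_neg, abs_of_nonneg (by norm_num)]; simp; ring
    · intro s hs x
      have h2 := ((gauss_hasFDerivAt s x).const_mul (s ^ b)).smul_const c
      unfold pd
      rw [h2.fderiv]
      simp only [ContinuousLinearMap.smulRight_apply, _root_.smul_apply,
        innerSL_apply_apply, smul_eq_mul, smul_smul, EuclideanSpace.inner_single_right]
      congr 1
      rw [Real.rpow_sub hs, Real.rpow_one]
      simp
      field_simp
  | coord a D K f j h ih =>
    have h1 := GB.coord _ _ _ _ j ih
    have hK := h.nonneg hR.le
    rw [show a - 1 / 2 + 1 / 2 = a + 1 / 2 - 1 / 2 by ring] at h1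
    have h2 := h.smul (if j = i then 1 else 0)
    have h2' : GB R (a + 1 / 2 - 1 / 2) (D + 1 + 1) K
        (fun s x => (if j = i then (1 : ℝ) else 0) • f s x) := by
      rw [show a + 1 / 2 - 1 / 2 = a by ring]
      refine GB.mono _ _ _ _ _ _ _ h2 (by omega) ?_ (fun _ _ _ => rfl)
      split_ifs <;> simp [hK]
    refine GB.mono _ _ _ _ _ _ _ (GB.add _ _ _ _ _ _ h2' h1) le_rfl (le_of_eq ?_) ?_
    · push_cast; field_simp; ring
    · intro s hs x
      have hj : HasFDerivAt (fun x : Euc d => x j) (EuclideanSpace.proj j : Euc d →L[ℝ] ℝ) x :=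
        (EuclideanSpace.proj j : Euc d →L[ℝ] ℝ).hasFDerivAt
      have := hj.smul (h.diffX s hs x).hasFDerivAt
      unfold pd
      have h3 : HasFDerivAt (fun x : Euc d => x j • f s x) _ x := this
      rw [h3.fderiv]
      simp [add_comm]
  | add a D K K' f g h1 h2 ih1 ih2 =>
    refine GB.mono _ _ _ _ _ _ _ (GB.add _ _ _ _ _ _ ih1 ih2) le_rfl (by rw [mul_add]) ?_
    intro s hs x
    unfold pd
    rw [fderiv_fun_add (h1.diffX s hs x) (h2.diffX s hs x)]
    rfl
  | mono a D D' K K' f g h hD hK he ih =>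
    have hK0 := h.nonneg hR.le
    refine GB.mono _ _ _ _ _ _ _ ih (by omega) ?_ ?_
    · gcongr
    · intro s hs x
      rw [show g s = f s from funext (he s hs)]

theorem GB.pdt {d : ℕ} {R a K : ℝ} {D : ℕ} {f : ℝ → Euc d → Euc d} (hR : 0 < R)
    (h : GB R a D K f) :
    GB R (a - 1) (D + 2) ((|a| + D / 2 + d * R ^ 2 / 4) * K)
      (fun s x => deriv (fun r => f r x) s) := by
  induction h with
  | base b c =>
    have h1 := (GB.base (R := R) (b - 1) c).smul b
    have h1' := GB.mono _ _ (0 + 1 + 1) _ _ _ _ h1 (by omega) le_rfl (fun _ _ _ => rfl)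
    have h2 := (GB.sum Finset.univ _ (fun j : Fin d =>
      GB.coord _ _ _ _ j (GB.coord _ _ _ _ j (GB.base (R := R) (b - 2) c)))).smul (1 / 4)
    rw [show b - 2 + 1 / 2 + 1 / 2 = b - 1 by ring] at h2
    refine GB.mono _ _ _ _ _ _ _ (GB.add _ _ _ _ _ _ h1' h2) le_rfl (le_of_eq ?_) ?_
    · rw [abs_of_nonneg (show (0 : ℝ) ≤ 1 / 4 by norm_num)]; simp; ring
    · intro s hs x
      rw [((gauss_hasDerivAt b s hs x).smul_const c).deriv, add_smul]
      congr 1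
      · simp only [smul_smul]
      · simp only [smul_smul]
        rw [← Finset.sum_smul, smul_smul]
        congr 1
        rw [EuclideanSpace.real_norm_sq_eq, Finset.sum_div, Finset.sum_mul, Finset.mul_sum]
        refine Finset.sum_congr rfl fun j _ => ?_
        ring
  | coord a D K f j h ih =>
    have h1 := GB.coord _ _ _ _ j ih
    have hK := h.nonneg hR.le
    rw [show a - 1 + 1 / 2 = a + 1 / 2 - 1 by ring] at h1
    refine GB.mono _ _ _ _ _ _ _ h1 (by omega) ?_ ?_
    · rw [mul_left_comm]
      gcongr ?_ * (_ * _)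
      have := abs_sub_abs_le_abs_sub a (-(1/2))
      rw [abs_neg, abs_of_nonneg (show (0 : ℝ) ≤ 1 / 2 by norm_num), sub_neg_eq_add] at this
      push_cast
      linarith
    · intro s hs x
      rw [deriv_fun_const_smul _ (h.diffT s hs x)]
  | add a D K K' f g h1 h2 ih1 ih2 =>
    refine GB.mono _ _ _ _ _ _ _ (GB.add _ _ _ _ _ _ ih1 ih2) le_rfl (by rw [mul_add]) ?_
    intro s hs x
    rw [deriv_fun_add (h1.diffT s hs x) (h2.diffT s hs x)]
  | mono a D D' K K' f g h hD hK he ih =>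
    have hK0 := h.nonneg hR.le
    refine GB.mono _ _ _ _ _ _ _ ih (by omega) ?_ ?_
    · gcongr
    · intro s hs x
      refine Filter.EventuallyEq.deriv_eq ?_
      filter_upwards [lt_mem_nhds hs] with r hr using he r hr x

theorem GB.bound {d : ℕ} {R a K : ℝ} {D : ℕ} {f : ℝ → Euc d → Euc d} (hR : 0 < R)
    (h : GB R a D K f) : ∀ t, 0 < t → ∀ x, ‖f t x‖ ≤
      K * (t ^ a * max 1 (‖x‖ / (√t * R)) ^ D * Real.exp (-‖x‖ ^ 2 / (4 * t))) := by
  induction h with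
  | base b c =>
    intro t ht x
    rw [norm_smul, Real.norm_of_nonneg (by positivity)]
    simp [mul_comm]
  | coord a D K f j h ih =>
    intro t ht x
    have hK := h.nonneg hR.le
    have ht' : 0 < √t := Real.sqrt_pos.2 ht
    rw [norm_smul, Real.rpow_add ht, ← Real.sqrt_eq_rpow, pow_succ]
    have h1 : ‖x j‖ ≤ √t * R * max 1 (‖x‖ / (√t * R)) := by
      calc ‖x j‖ ≤ ‖x‖ := PiLp.norm_apply_le x j
        _ = √t * R * (‖x‖ / (√t * R)) := by field_simp
        _ ≤ _ := by gcongr; exact le_max_right _ _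
    calc ‖x j‖ * ‖f t x‖ ≤ (√t * R * max 1 (‖x‖ / (√t * R))) * (K * (t ^ a * max 1 (‖x‖ / (√t * R)) ^ D * Real.exp (-‖x‖ ^ 2 / (4 * t)))) := by
          gcongr
          exact ih t ht x
      _ = _ := by ring
  | add a D K K' f g h1 h2 ih1 ih2 =>
    intro t ht x
    rw [add_mul]
    exact (norm_add_le _ _).trans (add_le_add (ih1 t ht x) (ih2 t ht x))
  | mono a D D' K K' f g h hD hK he ih =>
    intro t ht x
    have hK0 := h.nonneg hR.le
    rw [he t ht x]
    refine (ih t ht x).trans ?_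
    gcongr
    · exact hK0.trans hK
    · exact le_max_left _ _

theorem GB.iterT {d : ℕ} {R a K : ℝ} {D : ℕ} {f : ℝ → Euc d → Euc d} (hR : 0 < R)
    (h : GB R a D K f) (A E T : ℝ) (hT : A + E / 2 + d * R ^ 2 / 4 ≤ T) (k : ℕ)
    (hA : |a| + k ≤ A) (hE : (D : ℝ) + 2 * k ≤ E) :
    GB R (a - k) (D + 2 * k) (T ^ k * K) (fun s x => iteratedDeriv k (fun r => f r x) s) := by
  induction k with
  | zero => simpa using h
  | succ k ih =>
    push_cast at hA hE
    have h0 := ih (by linarith) (by linarith)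
    have h1 := h0.pdt hR
    have hK := h0.nonneg hR.le
    rw [show a - k - 1 = a - ((k + 1 : ℕ) : ℝ) by push_cast; ring] at h1
    refine GB.mono _ _ _ _ _ _ _ h1 (by omega) ?_ ?_
    · rw [pow_succ' T k, mul_assoc]
      gcongr
      have := abs_sub a (k : ℝ)
      rw [abs_of_nonneg (Nat.cast_nonneg k : (0 : ℝ) ≤ k)] at this
      push_cast
      linarith
    · intro s hs x
      rw [iteratedDeriv_succ]

theorem GB.iterX {d : ℕ} {R a K : ℝ} {D : ℕ} {f : ℝ → Euc d → Euc d} (hR : 0 < R)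
    (h : GB R a D K f) (i : Fin d) (E X : ℝ) (hX : E / R + R / 2 ≤ X) (n : ℕ)
    (hE : (D : ℝ) + n ≤ E) :
    GB R (a - n / 2) (D + n) (X ^ n * K) (fun s => (pd i)^[n] (f s)) := by
  induction n with
  | zero => simpa using h
  | succ n ih =>
    push_cast at hE
    have h0 := ih (by linarith)
    have h1 := h0.pdx hR i
    have hK := h0.nonneg hR.le
    rw [show a - n / 2 - 1 / 2 = a - ((n + 1 : ℕ) : ℝ) / 2 by push_cast; ring] at h1
    refine GB.mono _ _ _ _ _ _ _ h1 (by omega) ?_ ?_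
    · rw [pow_succ', mul_assoc]
      gcongr
      refine le_trans ?_ hX
      gcongr
      push_cast
      linarith
    · intro s hs x
      rw [Function.iterate_succ_apply']

theorem GB.iterL {d : ℕ} {R a K : ℝ} {D : ℕ} {f : ℝ → Euc d → Euc d} (hR : 0 < R)
    (h : GB R a D K f) (β : Fin d → ℕ) (E X : ℝ) (hX : E / R + R / 2 ≤ X) (l : List (Fin d))
    (hE : (D : ℝ) + ((l.map β).sum : ℕ) ≤ E) :
    GB R (a - ((l.map β).sum : ℕ) / 2) (D + (l.map β).sum) (X ^ (l.map β).sum * K)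
      (fun s => l.foldr (fun i g => (pd i)^[β i] g) (f s)) := by
  induction l with
  | nil => simpa using h
  | cons i l ih =>
    rw [List.map_cons, List.sum_cons] at hE ⊢
    push_cast at hE
    have hb : (0 : ℝ) ≤ β i := Nat.cast_nonneg _
    have h0 := ih (by push_cast; linarith)
    have h1 := h0.iterX hR i E X hX (β i) (by push_cast; linarith)
    set S := (l.map β).sum
    rw [show a - (S : ℝ) / 2 - (β i : ℝ) / 2 = a - ((β i + S : ℕ) : ℝ) / 2 by
      push_cast; ring] at h1
    refine GB.mono _ _ _ _ _ _ _ h1 (by omega) ?_ ?_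
    · rw [pow_add, mul_assoc]
    · intro s hs x
      rw [List.foldr_cons]

theorem gradHeat_eq {d : ℕ} (s : ℝ) (x : Euc d) :
    gradHeat d s x = (-(1 / (2 * s)) * heatKernel d s x) • x := by
  unfold gradHeat
  refine HasGradientAt.gradient ?_
  rw [hasGradientAt_iff_hasFDerivAt]
  refine ((gauss_hasFDerivAt s x).const_mul ((4 * Real.pi * s) ^ (-(d : ℝ) / 2))).congr_fderiv ?_
  ext v
  simp [heatKernel]
  ring

theorem GB.start {d : ℕ} {R : ℝ} (hR : 0 < R) (m : ℕ) :
    GB R (m - d / 2 - 1 / 2) 1 (d * R) (fun s x => s ^ m • gradHeat d s x) := by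
  have h0 : ∀ j : Fin d, GB R ((m : ℝ) - d / 2 - 1 / 2) 1 R (fun s x => x j •
      ((s ^ ((m : ℝ) - 1 - d / 2) * Real.exp (-‖x‖ ^ 2 / (4 * s))) •
        (EuclideanSpace.single j (1 : ℝ) : Euc d))) := by
    intro j
    have h := GB.coord _ _ _ _ j (GB.base (R := R) ((m : ℝ) - 1 - d / 2)
        (EuclideanSpace.single j (1 : ℝ) : Euc d))
    rw [show (m : ℝ) - 1 - d / 2 + 1 / 2 = m - d / 2 - 1 / 2 by ring] at h
    simpa using h
  have h1 := (GB.sum Finset.univ _ h0).smul (-(1 / 2) * (4 * Real.pi) ^ (-(d : ℝ) / 2))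
  refine GB.mono _ _ _ _ _ _ _ h1 le_rfl ?_ ?_
  · rw [Finset.card_univ, Fintype.card_fin]
    refine mul_le_of_le_one_left (by positivity) ?_
    have h4 : (4 * Real.pi) ^ (-(d : ℝ) / 2) ≤ 1 := by
      refine Real.rpow_le_one_of_one_le_of_nonpos (by nlinarith [Real.pi_gt_three]) ?_
      rw [neg_div]
      have : (0 : ℝ) ≤ d / 2 := by positivity
      linarith
    have h5 : 0 ≤ (4 * Real.pi) ^ (-(d : ℝ) / 2) := by positivity
    rw [abs_le]
    constructor <;> linarith
  · intro s hs x
    have hx : x = ∑ j, x j • (EuclideanSpace.single j (1 : ℝ) : Euc d) := by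
      ext i
      simp [Pi.single_apply]
    have hs2 : s ^ ((m : ℝ) - 1 - d / 2) = s ^ m * s⁻¹ * s ^ (-(d : ℝ) / 2) := by
      rw [show (m : ℝ) - 1 - d / 2 = m + (-1) + (-(d : ℝ) / 2) by ring, Real.rpow_add hs,
        Real.rpow_add hs, Real.rpow_natCast, Real.rpow_neg_one]
    have : ∑ j, x j • ((s ^ ((m : ℝ) - 1 - d / 2) * Real.exp (-‖x‖ ^ 2 / (4 * s))) •
        (EuclideanSpace.single j (1 : ℝ) : Euc d)) =
        (s ^ ((m : ℝ) - 1 - d / 2) * Real.exp (-‖x‖ ^ 2 / (4 * s))) • x := by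
      conv_rhs => rw [hx]
      rw [Finset.smul_sum]
      simp_rw [← hx]
      refine Finset.sum_congr rfl fun j _ => smul_comm _ _ _
    rw [this, gradHeat_eq, heatKernel, smul_smul, smul_smul, hs2,
      Real.mul_rpow (by positivity) hs.le]
    congr 1
    field_simp

theorem gauss_Lq {d : ℕ} (q : ℝ≥0∞) (hq : 1 ≤ q) (t : ℝ) (ht : 0 < t) :
    eLpNorm (fun x : Euc d => Real.exp (-‖x‖ ^ 2 / (8 * t))) q volume ≤
      ENNReal.ofReal ((8 * Real.pi) ^ ((d : ℝ) / 2) * t ^ ((d : ℝ) / 2 * q⁻¹.toReal)) := by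
  have hpi : (1 : ℝ) ≤ 8 * Real.pi := by nlinarith [Real.pi_gt_three]
  rcases eq_or_ne q ⊤ with rfl | hq'
  · rw [eLpNorm_exponent_top]
    refine (eLpNormEssSup_le_of_ae_bound (C := 1) (Eventually.of_forall fun x => ?_)).trans ?_
    · rw [Real.norm_of_nonneg (by positivity), Real.exp_le_one_iff]
      rw [neg_div]
      have : 0 ≤ ‖x‖ ^ 2 / (8 * t) := by positivity
      linarith
    · refine ENNReal.ofReal_le_ofReal ?_
      simp
      exact Real.one_le_rpow hpi (by positivity)
  · have hq0 : q ≠ 0 := by rintro rfl; simp at hq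
    have hr : 1 ≤ q.toReal := by
      have := ENNReal.toReal_mono hq' hq
      simpa using this
    have hr0 : 0 < q.toReal := by linarith
    set r := q.toReal with hrdef
    have hb : 0 < r / (8 * t) := by positivity
    have hI := GaussianFourier.integral_rexp_neg_mul_sq_norm (V := Euc d) hb
    have hint : Integrable (fun v : Euc d => Real.exp (-(r / (8 * t)) * ‖v‖ ^ 2)) := by
      by_contra hc
      rw [integral_undef hc] at hI
      have : (0 : ℝ) < (Real.pi / (r / (8 * t))) ^ ((Module.finrank ℝ (Euc d) : ℝ) / 2) := by
        positivity
      linarith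
    rw [eLpNorm_eq_lintegral_rpow_enorm_toReal hq0 hq']
    have he : ∀ x : Euc d, ‖Real.exp (-‖x‖ ^ 2 / (8 * t))‖ₑ ^ r =
        ENNReal.ofReal (Real.exp (-(r / (8 * t)) * ‖x‖ ^ 2)) := by
      intro x
      rw [Real.enorm_of_nonneg (Real.exp_pos _).le,
        ENNReal.ofReal_rpow_of_nonneg (Real.exp_pos _).le hr0.le, ← Real.exp_mul]
      congr 2
      ring
    simp_rw [← hrdef, he]
    rw [← ofReal_integral_eq_lintegral_ofReal hint
      (Eventually.of_forall fun x => (Real.exp_pos _).le), hI,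
      ENNReal.ofReal_rpow_of_nonneg (by positivity) (by positivity)]
    refine ENNReal.ofReal_le_ofReal ?_
    rw [ENNReal.toReal_inv, ← hrdef, ← Real.rpow_mul (by positivity)]
    rw [finrank_euclideanSpace_fin]
    have e1 : Real.pi / (r / (8 * t)) ≤ (8 * Real.pi) * t := by
      rw [div_div_eq_mul_div, div_le_iff₀ hr0]
      nlinarith [mul_pos Real.pi_pos ht]
    calc (Real.pi / (r / (8 * t))) ^ ((d : ℝ) / 2 * (1 / r))
        ≤ ((8 * Real.pi) * t) ^ ((d : ℝ) / 2 * (1 / r)) := by gcongr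
      _ = (8 * Real.pi) ^ ((d : ℝ) / 2 * (1 / r)) * t ^ ((d : ℝ) / 2 * (1 / r)) :=
          Real.mul_rpow (by positivity) ht.le
      _ ≤ _ := by
          rw [one_div]
          gcongr
          exact mul_le_of_le_one_right (by positivity) (inv_le_one_of_one_le₀ hr)

theorem poly_gauss (N : ℕ) (D : ℕ) (hD : D ≤ 3 * N) (y : ℝ) :
    max 1 y ^ D ≤ ((24 : ℝ) ^ 3) ^ N * Real.exp (N * y ^ 2 / 8) := by
  have h1 : max 1 y ≤ 24 * Real.exp (y ^ 2 / 24) := by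
    have := Real.add_one_le_exp (y ^ 2 / 24)
    refine max_le ?_ ?_ <;> nlinarith [sq_nonneg (y - 1), sq_nonneg y]
  calc max 1 y ^ D ≤ max 1 y ^ (3 * N) := pow_le_pow_right₀ (le_max_left _ _) hD
    _ ≤ (24 * Real.exp (y ^ 2 / 24)) ^ (3 * N) := by gcongr
    _ = _ := by
      rw [mul_pow, ← pow_mul, ← Real.exp_nat_mul]
      congr 2
      push_cast
      ring

/-- space-time derivative estimates for `t^m ∇G(·,t)`. -/
theorem heatKernel_grad_spacetime_deriv_Lq_bound (d : ℕ) (hd : 1 ≤ d) :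
    ∃ M₀ : ℝ, 0 < M₀ ∧
      ∀ (β : Fin d → ℕ) (k m : ℕ), 0 < msize β + k → m ≤ k →
        ∀ (q : ℝ≥0∞), 1 ≤ q → ∀ t : ℝ, 0 < t →
          eLpNorm (mderiv β (tderiv k (fun s x => s ^ m • gradHeat d s x) t)) q volume ≤
            ENNReal.ofReal
              (M₀ ^ ((msize β : ℝ) / 2 + (k : ℝ)) *
                ((msize β : ℝ) + (k : ℝ)) ^
                  (((msize β : ℝ) + 1) / 2 + (k : ℝ) + ((d : ℝ) / 2) * (1 - q⁻¹.toReal)) *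
                t ^ (-(((msize β : ℝ) + 2 * ((k : ℝ) - (m : ℝ)) + 1) / 2) -
                      ((d : ℝ) / 2) * (1 - q⁻¹.toReal))) := by
  set C : ℝ := (d : ℝ) + 4 with hC
  have hd1 : (1 : ℝ) ≤ d := by exact_mod_cast hd
  have hC1 : 1 ≤ C := by linarith
  have hpi : (1 : ℝ) ≤ 8 * Real.pi := by nlinarith [Real.pi_gt_three]
  set P : ℝ := (8 * Real.pi) ^ ((d : ℝ) / 2) with hP
  have hP1 : 1 ≤ P := Real.one_le_rpow hpi (by positivity)
  set A : ℝ := d * P * (C * 24 ^ 3) with hA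
  have hdP : 1 ≤ d * P := one_le_mul_of_one_le_of_one_le hd1 hP1
  have hA1 : 1 ≤ A :=
    one_le_mul_of_one_le_of_one_le hdP (one_le_mul_of_one_le_of_one_le hC1 (by norm_num))
  have hA0 : 0 < A := by linarith
  refine ⟨A ^ 2, by positivity, ?_⟩
  intro β k m hN hm q hq t ht
  set b := msize β with hb
  set N : ℕ := b + k with hNdef
  have hN1 : (1 : ℝ) ≤ N := by exact_mod_cast hN
  have hN0 : (0 : ℝ) < N := by linarith
  have hNr : (N : ℝ) = b + k := by rw [hNdef]; push_cast; ring
  set R : ℝ := √(N : ℝ) with hRdef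
  have hR : 0 < R := Real.sqrt_pos.2 hN0
  have hR2 : R ^ 2 = N := Real.sq_sqrt hN0.le
  have hb0 : (0 : ℝ) ≤ b := Nat.cast_nonneg _
  have hk0 : (0 : ℝ) ≤ k := Nat.cast_nonneg _
  have hm0 : (0 : ℝ) ≤ m := Nat.cast_nonneg _
  have hmk : (m : ℝ) ≤ k := by exact_mod_cast hm
  have h0 := GB.start (d := d) hR m
  have h1 := h0.iterT hR ((2 + (d + 1) / 2) * N) (3 * N) (C * N)
    (by rw [hR2, hC]; nlinarith) k
    (by
      have : |(m : ℝ) - d / 2 - 1 / 2| ≤ m + (d + 1) / 2 := by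
        rw [abs_le]; constructor <;> linarith
      nlinarith)
    (by push_cast; linarith)
  have hsum : ((List.finRange d).map β).sum = b := by
    rw [hb, msize, Fin.sum_univ_def]
  have h2 := h1.iterL hR β (3 * N) (C * R)
    (by
      rw [← hR2, hC]
      have : 3 * R ^ 2 / R = 3 * R := by field_simp
      rw [this]
      nlinarith) (List.finRange d)
    (by rw [hsum]; push_cast; linarith)
  rw [hsum] at h2
  have hpt : ∀ x : Euc d,
      ‖mderiv β (tderiv k (fun s x => s ^ m • gradHeat d s x) t) x‖ ≤
      ((C * R) ^ b * ((C * N) ^ k * (d * R)) * t ^ ((m : ℝ) - d / 2 - 1 / 2 - k - b / 2) *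
        ((24 : ℝ) ^ 3) ^ N) * Real.exp (-‖x‖ ^ 2 / (8 * t)) := by
    intro x
    have h3 := h2.bound hR t ht x
    have h4 := poly_gauss N (1 + 2 * k + b) (by omega) (‖x‖ / (√t * R))
    have h5 : (N : ℝ) * (‖x‖ / (√t * R)) ^ 2 / 8 = ‖x‖ ^ 2 / (8 * t) := by
      rw [div_pow, mul_pow, hR2, Real.sq_sqrt ht.le]
      field_simp
    rw [h5] at h4
    have h6 : Real.exp (-‖x‖ ^ 2 / (8 * t)) =
        Real.exp (‖x‖ ^ 2 / (8 * t)) * Real.exp (-‖x‖ ^ 2 / (4 * t)) := by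
      rw [← Real.exp_add]
      congr 1
      field_simp
      ring
    refine h3.trans ?_
    rw [h6]
    have hKn := h2.nonneg hR.le
    calc _ ≤ (C * R) ^ b * ((C * N) ^ k * (d * R)) *
          (t ^ ((m : ℝ) - d / 2 - 1 / 2 - k - b / 2) *
            (((24 : ℝ) ^ 3) ^ N * Real.exp (‖x‖ ^ 2 / (8 * t))) *
              Real.exp (-‖x‖ ^ 2 / (4 * t))) := by gcongr
      _ = _ := by ring
  refine (eLpNorm_mono_real hpt).trans ?_
  set c : ℝ := (C * R) ^ b * ((C * N) ^ k * (d * R)) *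
    t ^ ((m : ℝ) - d / 2 - 1 / 2 - k - b / 2) * ((24 : ℝ) ^ 3) ^ N with hc
  have hc0 : 0 ≤ c := by positivity
  have h7 := eLpNorm_const_smul c (fun x : Euc d => Real.exp (-‖x‖ ^ 2 / (8 * t))) q volume
  have h8 : (c • fun x : Euc d => Real.exp (-‖x‖ ^ 2 / (8 * t))) =
      fun x => c * Real.exp (-‖x‖ ^ 2 / (8 * t)) := rfl
  rw [h8] at h7
  rw [h7, Real.enorm_of_nonneg hc0]
  refine (mul_le_mul_right (gauss_Lq q hq t ht) _).trans ?_
  rw [← ENNReal.ofReal_mul hc0]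
  refine ENNReal.ofReal_le_ofReal ?_
  set w := q⁻¹.toReal with hw
  have hw1 : w ≤ 1 := by
    have := ENNReal.toReal_mono ENNReal.one_ne_top (ENNReal.inv_le_one.2 hq)
    rwa [ENNReal.toReal_one] at this
  rw [← hNr]
  have et : t ^ (-(((b : ℝ) + 2 * ((k : ℝ) - (m : ℝ)) + 1) / 2) - ((d : ℝ) / 2) * (1 - w)) =
      t ^ ((m : ℝ) - d / 2 - 1 / 2 - k - b / 2) * t ^ ((d : ℝ) / 2 * w) := by
    rw [← Real.rpow_add ht]
    congr 1
    ring
  have eR : R ^ b * N ^ k * R = (N : ℝ) ^ (((b : ℝ) + 1) / 2 + k) := by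
    rw [hRdef, Real.sqrt_eq_rpow, ← Real.rpow_natCast, ← Real.rpow_natCast, ← Real.rpow_mul hN0.le,
      ← Real.rpow_add hN0, ← Real.rpow_add hN0]
    congr 1
    ring
  have eN : (N : ℝ) ^ (((b : ℝ) + 1) / 2 + k) ≤
      (N : ℝ) ^ (((b : ℝ) + 1) / 2 + k + ((d : ℝ) / 2) * (1 - w)) := by
    refine Real.rpow_le_rpow_of_exponent_le hN1 ?_
    have : 0 ≤ (d : ℝ) / 2 * (1 - w) := mul_nonneg (by positivity) (by linarith)
    linarith
  have eA : d * P * (C * 24 ^ 3) ^ N ≤ (A ^ 2) ^ ((b : ℝ) / 2 + k) := by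
    have e1 : (A ^ 2) ^ ((b : ℝ) / 2 + k) = A ^ (b + 2 * k) := by
      rw [← Real.rpow_natCast A 2, ← Real.rpow_mul hA0.le, ← Real.rpow_natCast A (b + 2 * k)]
      congr 1
      push_cast
      ring
    rw [e1]
    calc d * P * (C * 24 ^ 3) ^ N ≤ (d * P) ^ N * (C * 24 ^ 3) ^ N := by
          gcongr
          exact le_self_pow₀ hdP (by omega)
      _ = A ^ N := by rw [hA, mul_pow (d * P) (C * 24 ^ 3) N]
      _ ≤ A ^ (b + 2 * k) := pow_le_pow_right₀ hA1 (by omega)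
  rw [et]
  calc _ = (d * P * (C * 24 ^ 3) ^ N) * (R ^ b * N ^ k * R) *
        (t ^ ((m : ℝ) - d / 2 - 1 / 2 - k - b / 2) * t ^ ((d : ℝ) / 2 * w)) := by
        rw [hc, mul_pow C (24 ^ 3) N, mul_pow, mul_pow]
        rw [show C ^ N = C ^ b * C ^ k by rw [← pow_add]]
        ring
    _ ≤ _ := by
        rw [eR]
        gcongr

end
end

section
/- For every dimension d ∈ ℕ, d ≥ 1, there exists a constant M₀ > 0 such that for every f ∈ L¹(ℝ^d), every multi-index β ∈ ℕ^d and integers k, m ∈ ℕ with |β| + k > 0 and 0 ≤ m ≤ k, for every 1 ≤ q ≤ ∞ and every t > 0, ‖D_x^β ∂_t^k (t^m G(·,t) ∗ f)‖_{L^q(ℝ^d)} ≤ M₀^{|β|/2 + k} (|β|+k)^{|β|/2 + k + (d/2)(1−1/q)} t^{−(|β|+2(k−m))/2 − (d/2)(1−1/q)} ‖f‖_{L¹(ℝ^d)}. -/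
open MeasureTheory Real Filter
open scoped ENNReal BigOperators Topology

noncomputable section

/-- Coordinate projection. -/
def hkP {d : ℕ} (i : Fin d) : Euc d →L[ℝ] ℝ := EuclideanSpace.proj i

lemma hkP_apply {d : ℕ} (i : Fin d) (z : Euc d) : hkP i z = z i := rfl

lemma hkP_hasFDerivAt {d : ℕ} (i : Fin d) (z : Euc d) :
    HasFDerivAt (fun z : Euc d => z i) (hkP i) z := (hkP i).hasFDerivAt

/-- Monomial. -/
def hkMon {d : ℕ} (α : Fin d → ℕ) (z : Euc d) : ℝ := ∏ i, z i ^ α i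

/-- Normalised kernel. -/
def hkK {d : ℕ} (α : Fin d → ℕ) (h s : ℝ) (z : Euc d) : ℝ :=
  s ^ (h - (msize α : ℝ) / 2) * (hkMon α z * Real.exp (-‖z‖ ^ 2 / (4 * s)))

lemma hkMon_abs_le {d : ℕ} (α : Fin d → ℕ) (z : Euc d) : |hkMon α z| ≤ ‖z‖ ^ msize α := by
  unfold hkMon msize
  rw [Finset.abs_prod, ← Finset.prod_pow_eq_pow_sum]
  refine Finset.prod_le_prod (fun i _ => abs_nonneg _) fun i _ => ?_
  rw [abs_pow]
  have := PiLp.norm_apply_le z i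
  rw [Real.norm_eq_abs] at this
  gcongr

lemma hkMon_continuous {d : ℕ} (α : Fin d → ℕ) : Continuous (hkMon α) := by
  unfold hkMon; fun_prop

lemma hkK_continuous {d : ℕ} (α : Fin d → ℕ) (h s : ℝ) : Continuous (hkK α h s) := by
  have := hkMon_continuous α
  unfold hkK; fun_prop

lemma msize_add {d : ℕ} (α β : Fin d → ℕ) : msize (α + β) = msize α + msize β := by
  simp [msize, Finset.sum_add_distrib]

lemma msize_single {d : ℕ} (i : Fin d) (n : ℕ) : msize (Pi.single i n) = n := by
  simp [msize]

lemma msize_sub {d : ℕ} (α : Fin d → ℕ) (i : Fin d) (hi : α i ≠ 0) :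
    msize (α - Pi.single i 1) + 1 = msize α := by
  have : α = (α - Pi.single i 1) + Pi.single i 1 := by
    funext j
    by_cases hj : j = i
    · subst hj; simp; omega
    · simp [hj]
  conv_rhs => rw [this]
  rw [msize_add, msize_single]

lemma le_msize {d : ℕ} (α : Fin d → ℕ) (i : Fin d) : α i ≤ msize α :=
  Finset.single_le_sum (f := α) (fun _ _ => Nat.zero_le _) (Finset.mem_univ i)

lemma msize_sub_le {d : ℕ} (α : Fin d → ℕ) (i : Fin d) :
    msize (α - Pi.single i 1) ≤ msize α :=
  Finset.sum_le_sum fun j _ => by simp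

lemma hkMon_add {d : ℕ} (α : Fin d → ℕ) (i : Fin d) (n : ℕ) (z : Euc d) :
    hkMon (α + Pi.single i n) z = z i ^ n * hkMon α z := by
  unfold hkMon
  simp only [Pi.add_apply, pow_add, Finset.prod_mul_distrib]
  rw [mul_comm]
  congr 1
  rw [Finset.prod_eq_single i]
  · simp
  · intro b _ hb; simp [hb]
  · simp

lemma hkK_bound {d : ℕ} (α : Fin d → ℕ) (h s : ℝ) (hs : 0 < s) (z : Euc d) (N : ℕ) (hN : 1 ≤ N)
    (hα : msize α ≤ 2 * N) :
    |hkK α h s z| ≤ 8 ^ N * (N : ℝ) ^ ((msize α : ℝ) / 2) * s ^ h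
      * Real.exp (-‖z‖ ^ 2 / (8 * s)) := by
  set n := msize α with hn
  have hN0 : (0:ℝ) < N := by exact_mod_cast hN
  have hnN : (n:ℝ) ≤ 2 * N := by exact_mod_cast hα
  have hr := norm_nonneg z
  set r := ‖z‖ with hrr
  have h1 : r ^ 2 ≤ 8 * N * s * Real.exp (r ^ 2 / (8 * N * s)) := by
    have := Real.add_one_le_exp (r ^ 2 / (8 * N * s))
    have h2 : r ^ 2 / (8 * N * s) ≤ Real.exp (r ^ 2 / (8 * N * s)) := by linarith
    rw [div_le_iff₀ (by positivity)] at h2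
    linarith
  have h2 : r ^ n ≤ (8 * N * s) ^ ((n:ℝ)/2) * Real.exp (r ^ 2 / (8 * s)) := by
    have e1 : r ^ n = (r ^ 2) ^ ((n:ℝ)/2) := by
      rw [← Real.rpow_natCast, ← Real.rpow_natCast, ← Real.rpow_mul hr]
      congr 1; push_cast; ring
    rw [e1]
    calc (r ^ 2) ^ ((n:ℝ)/2) ≤ (8 * N * s * Real.exp (r ^ 2 / (8 * N * s))) ^ ((n:ℝ)/2) :=
          Real.rpow_le_rpow (by positivity) h1 (by positivity)
      _ = (8 * N * s) ^ ((n:ℝ)/2) * Real.exp (r ^ 2 / (8 * N * s) * ((n:ℝ)/2)) := by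
          rw [Real.mul_rpow (by positivity) (by positivity), ← Real.exp_mul]
      _ ≤ _ := by
          gcongr
          calc r ^ 2 / (8 * N * s) * ((n:ℝ)/2) ≤ r ^ 2 / (8 * N * s) * N := by
                gcongr; linarith
            _ = _ := by field_simp
  have h3 : (8 * (N:ℝ) * s) ^ ((n:ℝ)/2) ≤ 8 ^ N * (N:ℝ) ^ ((n:ℝ)/2) * s ^ ((n:ℝ)/2) := by
    rw [Real.mul_rpow (by positivity) hs.le, Real.mul_rpow (by positivity) (by positivity)]
    gcongr
    rw [← Real.rpow_natCast]
    exact Real.rpow_le_rpow_of_exponent_le (by norm_num) (by linarith)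
  unfold hkK
  rw [abs_mul, abs_mul, abs_of_pos (Real.rpow_pos_of_pos hs _), abs_of_pos (Real.exp_pos _)]
  have h4 : Real.exp (-r ^ 2 / (4 * s)) =
      Real.exp (-r ^ 2 / (8 * s)) * Real.exp (-(r ^ 2 / (8 * s))) := by
    rw [← Real.exp_add]; congr 1; field_simp; ring
  have h5 : s ^ h = s ^ (h - (n:ℝ)/2) * s ^ ((n:ℝ)/2) := by
    rw [← Real.rpow_add hs]; congr 1; ring
  calc s ^ (h - (n:ℝ)/2) * (|hkMon α z| * Real.exp (-r ^ 2 / (4 * s)))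
      ≤ s ^ (h - (n:ℝ)/2) * ((8 ^ N * (N:ℝ) ^ ((n:ℝ)/2) * s ^ ((n:ℝ)/2)
          * Real.exp (r ^ 2 / (8 * s))) * Real.exp (-r ^ 2 / (4 * s))) := by
        gcongr
        refine (hkMon_abs_le α z).trans (h2.trans ?_)
        gcongr
    _ = _ := by
        rw [h4, h5, Real.exp_neg]; field_simp

lemma hkK_bdd {d : ℕ} (α : Fin d → ℕ) (h : ℝ) :
    ∃ C : ℝ, 0 ≤ C ∧ ∀ s, 0 < s → ∀ z : Euc d, |hkK α h s z| ≤ C * s ^ h := by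
  refine ⟨8 ^ (msize α + 1) * ((msize α + 1 : ℕ) : ℝ) ^ ((msize α : ℝ) / 2), by positivity, ?_⟩
  intro s hs z
  refine (hkK_bound α h s hs z (msize α + 1) (by omega) (by omega)).trans ?_
  refine mul_le_of_le_one_right (by positivity) ?_
  rw [Real.exp_le_one_iff]
  apply div_nonpos_of_nonpos_of_nonneg
  · nlinarith [norm_nonneg z]
  · positivity

lemma hkK_hasDerivAt {d : ℕ} (α : Fin d → ℕ) (h s : ℝ) (hs : 0 < s) (z : Euc d) :
    HasDerivAt (fun s => hkK α h s z)
      ((h - (msize α : ℝ) / 2) * hkK α (h - 1) s z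
        + ∑ i, (1/4 : ℝ) * hkK (α + Pi.single i 2) (h - 1) s z) s := by
  unfold hkK
  have h1 : HasDerivAt (fun s : ℝ => s ^ (h - (msize α : ℝ) / 2)) _ s :=
    Real.hasDerivAt_rpow_const (Or.inl hs.ne')
  have h2 : HasDerivAt (fun s : ℝ => -‖z‖ ^ 2 / (4 * s)) (‖z‖ ^ 2 / (4 * s ^ 2)) s := by
    have := ((hasDerivAt_id s).const_mul (4:ℝ)).fun_inv (by simp; exact hs.ne')
    have := this.const_mul (-‖z‖ ^ 2)
    simp only [id] at this
    convert! this using 1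
    field_simp
  have h3 := h1.mul ((h2.exp).const_mul (hkMon α z))
  refine h3.congr_deriv ?_
  simp only [hkMon_add, msize_add, msize_single]
  rw [EuclideanSpace.real_norm_sq_eq]
  have e1 : s ^ (h - 1 - ((msize α + 2 : ℕ) : ℝ) / 2) = s ^ (h - (msize α : ℝ) / 2) / s ^ 2 := by
    rw [← Real.rpow_natCast s 2, ← Real.rpow_sub hs]; congr 1; push_cast; ring
  have e2 : s ^ (h - (msize α : ℝ) / 2 - 1) = s ^ (h - (msize α : ℝ) / 2) / s := by
    rw [Real.rpow_sub hs, Real.rpow_one]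
  have e3 : s ^ (h - 1 - (msize α : ℝ) / 2) = s ^ (h - (msize α : ℝ) / 2) / s := by
    rw [← e2]; congr 1; ring
  rw [e1, e2, e3]
  congr 1
  · ring
  · rw [Finset.sum_div, Finset.mul_sum, Finset.mul_sum, Finset.mul_sum]
    refine Finset.sum_congr rfl fun i _ => ?_
    field_simp

lemma hkMon_hasFDerivAt {d : ℕ} (α : Fin d → ℕ) (z : Euc d) :
    HasFDerivAt (hkMon α) (∑ i, ((α i : ℝ) * hkMon (α - Pi.single i 1) z) •
      hkP i) z := by
  have h1 : ∀ i ∈ (Finset.univ : Finset (Fin d)), HasFDerivAt (fun z : Euc d => z i ^ α i)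
      (((α i : ℝ) * z i ^ (α i - 1)) • hkP i) z := by
    intro i _
    have h0 : HasFDerivAt (fun z : Euc d => z i) (hkP i) z :=
      hkP_hasFDerivAt i z
    have := h0.pow (α i)
    convert! this using 1
    simp
  have h2 := HasFDerivAt.finsetProd h1
  refine h2.congr_fderiv ?_
  refine Finset.sum_congr rfl fun i _ => ?_
  rw [smul_smul]
  congr 1
  unfold hkMon
  rw [← Finset.mul_prod_erase _ _ (Finset.mem_univ i)]
  have : ∏ x ∈ Finset.univ.erase i, z.ofLp x ^ ((α - Pi.single i 1 : Fin d → ℕ) x)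
      = ∏ x ∈ Finset.univ.erase i, z.ofLp x ^ α x := by
    refine Finset.prod_congr rfl fun j hj => ?_
    simp [Finset.ne_of_mem_erase hj]
  rw [this]
  simp; ring

lemma hkK_hasFDerivAt {d : ℕ} (α : Fin d → ℕ) (h s : ℝ) (hs : 0 < s) (z : Euc d) :
    HasFDerivAt (hkK α h s)
      (∑ i, ((α i : ℝ) * hkK (α - Pi.single i 1) (h - 1/2) s z
        - 1/2 * hkK (α + Pi.single i 1) (h - 1/2) s z) •
      hkP i) z := by
  have h2 : HasFDerivAt (fun z : Euc d => -‖z‖ ^ 2 / (4 * s))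
      (∑ i, (- z i / (2 * s)) • hkP i) z := by
    have h3 := (hasStrictFDerivAt_norm_sq z).hasFDerivAt.const_mul (-(1 / (4 * s)))
    have e : (fun z : Euc d => -‖z‖ ^ 2 / (4 * s)) = fun z : Euc d => -(1 / (4 * s)) * ‖z‖ ^ 2 := by
      funext z; ring
    rw [e]
    refine h3.congr_fderiv ?_
    refine ContinuousLinearMap.ext fun v => ?_
    simp [hkP_apply, PiLp.inner_apply, Finset.mul_sum, _root_.sum_apply]
    rw [← Finset.sum_neg_distrib]
    refine Finset.sum_congr rfl fun i _ => ?_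
    field_simp; ring
  have h3 := ((hkMon_hasFDerivAt α z).mul h2.exp).const_mul (s ^ (h - (msize α : ℝ) / 2))
  refine h3.congr_fderiv ?_
  rw [Finset.smul_sum, Finset.smul_sum, Finset.smul_sum, ← Finset.sum_add_distrib, Finset.smul_sum]
  refine Finset.sum_congr rfl fun i _ => ?_
  simp only [smul_smul, ← add_smul]
  congr 1
  unfold hkK
  rw [hkMon_add, msize_add, msize_single]
  have e1 : s ^ (h - 1/2 - ((msize α + 1 : ℕ) : ℝ) / 2) = s ^ (h - (msize α : ℝ) / 2) / s := by
    rw [← Real.rpow_sub_one hs.ne']; congr 1; push_cast; ring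
  rw [e1]
  have e2 : (α i : ℝ) * (s ^ (h - 1/2 - ((msize (α - Pi.single i 1) : ℕ) : ℝ) / 2) *
      (hkMon (α - Pi.single i 1) z * Real.exp (-‖z‖ ^ 2 / (4 * s)))) =
      (α i : ℝ) * (s ^ (h - (msize α : ℝ) / 2) *
      (hkMon (α - Pi.single i 1) z * Real.exp (-‖z‖ ^ 2 / (4 * s)))) := by
    by_cases hi : α i = 0
    · simp [hi]
    · have := msize_sub α i hi
      congr 3
      rw [← this]; push_cast; ring
  rw [e2]
  field_simp
  ring

/-- Convolution with the normalised kernel. -/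
def hkE {d : ℕ} (f : Euc d → ℝ) (α : Fin d → ℕ) (h s : ℝ) (x : Euc d) : ℝ :=
  ∫ y, hkK α h s (x - y) * f y

lemma hkE_aesm {d : ℕ} (α : Fin d → ℕ) (h s : ℝ) (x : Euc d) :
    AEStronglyMeasurable (fun y => hkK α h s (x - y)) volume :=
  ((hkK_continuous α h s).comp (continuous_const.sub continuous_id)).aestronglyMeasurable

lemma hkE_integrable {d : ℕ} {f : Euc d → ℝ} (hf : Integrable f) (α : Fin d → ℕ) (h s : ℝ)
    (hs : 0 < s) (x : Euc d) : Integrable (fun y => hkK α h s (x - y) * f y) := by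
  obtain ⟨C, hC0, hC⟩ := hkK_bdd α h
  refine Integrable.bdd_mul (c := C * s ^ h) hf (hkE_aesm α h s x) ?_
  exact Filter.Eventually.of_forall fun y => hC s hs _

lemma hkE_hasDerivAt {d : ℕ} {f : Euc d → ℝ} (hf : Integrable f) (α : Fin d → ℕ) (h s : ℝ)
    (hs : 0 < s) (x : Euc d) :
    HasDerivAt (fun s => hkE f α h s x)
      ((h - (msize α : ℝ) / 2) * hkE f α (h - 1) s x
        + ∑ i, (1/4 : ℝ) * hkE f (α + Pi.single i 2) (h - 1) s x) s := by
  choose C hC0 hC using fun α : Fin d → ℕ => hkK_bdd α (h - 1)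
  have hcont : ContinuousOn (fun s : ℝ => s ^ (h - 1)) (Set.Icc (s / 2) (2 * s)) := by
    intro r hr
    exact (Real.continuousAt_rpow_const r _ (Or.inl (by
      have := hr.1; intro h0; rw [h0] at this; linarith))).continuousWithinAt
  obtain ⟨B, hB⟩ := isCompact_Icc.exists_bound_of_continuousOn hcont
  have key := hasDerivAt_integral_of_dominated_loc_of_deriv_le (μ := (volume : Measure (Euc d)))
    (F := fun s y => hkK α h s (x - y) * f y)
    (F' := fun s y => ((h - (msize α : ℝ) / 2) * hkK α (h - 1) s (x - y)
        + ∑ i, (1/4 : ℝ) * hkK (α + Pi.single i 2) (h - 1) s (x - y)) * f y)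
    (x₀ := s) (s := Set.Icc (s / 2) (2 * s))
    (bound := fun y => (|h - (msize α : ℝ) / 2| * (C α * B)
        + ∑ i, (1/4 : ℝ) * (C (α + Pi.single i 2) * B)) * ‖f y‖)
    (Icc_mem_nhds (by linarith) (by linarith))
    (Filter.Eventually.of_forall fun r => (hkE_aesm α h r x).mul hf.aestronglyMeasurable)
    (hkE_integrable hf α h s hs x)
    (by
      refine AEStronglyMeasurable.mul ?_ hf.aestronglyMeasurable
      refine ((hkE_aesm _ _ _ x).const_mul _).add ?_
      exact Finset.aestronglyMeasurable_fun_sum _ fun i _ => (hkE_aesm _ _ _ x).const_mul _)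
    (by
      refine Filter.Eventually.of_forall fun y r hr => ?_
      have hr0 : 0 < r := by linarith [hr.1]
      have hrB : r ^ (h - 1) ≤ B := (le_abs_self _).trans (hB r hr)
      rw [norm_mul]
      gcongr
      refine (norm_add_le _ _).trans (add_le_add ?_ ((norm_sum_le _ _).trans ?_))
      · rw [norm_mul, Real.norm_eq_abs, Real.norm_eq_abs]
        gcongr
        exact (hC α r hr0 _).trans (by gcongr; exact hC0 _)
      · refine Finset.sum_le_sum fun i _ => ?_
        rw [norm_mul, Real.norm_eq_abs, Real.norm_eq_abs, abs_of_pos (by norm_num : (0:ℝ) < 1/4)]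
        gcongr
        exact (hC _ r hr0 _).trans (by gcongr; exact hC0 _))
    (hf.norm.const_mul _)
    (by
      refine Filter.Eventually.of_forall fun y r hr => ?_
      have hr0 : 0 < r := by linarith [hr.1]
      exact (hkK_hasDerivAt α h r hr0 (x - y)).mul_const _)
  refine key.2.congr_deriv ?_
  have e : (fun y => ((h - (msize α : ℝ) / 2) * hkK α (h - 1) s (x - y)
        + ∑ i, (1/4 : ℝ) * hkK (α + Pi.single i 2) (h - 1) s (x - y)) * f y)
      = fun y => (h - (msize α : ℝ) / 2) * (hkK α (h - 1) s (x - y) * f y)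
        + ∑ i, (1/4 : ℝ) * (hkK (α + Pi.single i 2) (h - 1) s (x - y) * f y) := by
    funext y
    rw [add_mul, Finset.sum_mul]
    simp only [mul_assoc]
  rw [e, integral_add, integral_const_mul, integral_finsetSum]
  · simp only [integral_const_mul]
    rfl
  · exact fun i _ => (hkE_integrable hf _ _ _ hs x).const_mul _
  · exact (hkE_integrable hf _ _ _ hs x).const_mul _
  · exact integrable_finsetSum _ fun i _ => (hkE_integrable hf _ _ _ hs x).const_mul _

lemma hk_sum_aux {d : ℕ} {Ω F : Type*} [MeasurableSpace Ω] (μ : Measure Ω)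
    [NormedAddCommGroup F] [NormedSpace ℝ F] [CompleteSpace F] (φ : Fin d → Ω → ℝ)
    (hφ : ∀ i, Integrable (φ i) μ) (v : Fin d → F) :
    AEStronglyMeasurable (fun y => ∑ i, φ i y • v i) μ ∧
      ∫ y, ∑ i, φ i y • v i ∂μ = ∑ i, (∫ y, φ i y ∂μ) • v i := by
  have h : ∀ i ∈ (Finset.univ : Finset (Fin d)), Integrable (fun y => φ i y • v i) μ :=
    fun i _ => (hφ i).smul_const _
  refine ⟨(integrable_finsetSum _ h).aestronglyMeasurable, ?_⟩
  rw [integral_finsetSum _ h]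
  exact Finset.sum_congr rfl fun i _ => integral_smul_const _ _

lemma hk_abstract_fderiv {d : ℕ} {f : Euc d → ℝ} (hf : Integrable f) (K : Euc d → ℝ)
    (g : Fin d → Euc d → ℝ) (hK : Continuous K) (hg : ∀ i, Continuous (g i)) (B : ℝ)
    (hKB : ∀ z, |K z| ≤ B) (C : Fin d → ℝ) (hgC : ∀ i z, |g i z| ≤ C i)
    (hd : ∀ z, HasFDerivAt K (∑ i, g i z • hkP i) z)
    (x : Euc d) :
    HasFDerivAt (fun x => ∫ y, K (x - y) * f y)
      (∑ i, (∫ y, g i (x - y) * f y) • hkP i) x := by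
  have hm : ∀ (k : Euc d → ℝ), Continuous k → ∀ x : Euc d,
      AEStronglyMeasurable (fun y => k (x - y)) (volume : Measure (Euc d)) := fun k hk x =>
    (hk.comp (continuous_const.sub continuous_id)).aestronglyMeasurable
  have hint : ∀ i : Fin d, Integrable (fun y => g i (x - y) * f y) := fun i =>
    Integrable.bdd_mul (c := C i) hf (hm _ (hg i) x) (Filter.Eventually.of_forall fun y => hgC i _)
  let F' : Euc d → Euc d → (Euc d →L[ℝ] ℝ) := fun x y => ∑ i, (g i (x - y) * f y) •
      hkP i
  let bound : Euc d → ℝ := fun y =>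
    (∑ i, C i * ‖hkP i‖) * ‖f y‖
  have h_bound : ∀ y x, ‖F' x y‖ ≤ bound y := by
    intro y r
    simp only [F', bound]
    rw [Finset.sum_mul]
    refine (norm_sum_le _ _).trans (Finset.sum_le_sum fun i _ => ?_)
    rw [norm_smul, norm_mul, mul_assoc, mul_assoc, mul_comm ‖f y‖]
    exact mul_le_mul_of_nonneg_right (hgC i _) (by positivity)
  have h_diff : ∀ y x, HasFDerivAt (fun x => K (x - y) * f y) (F' x y) x := by
    intro y r
    have h2 : HasFDerivAt (fun r : Euc d => r - y) (ContinuousLinearMap.id ℝ (Euc d)) r :=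
      (hasFDerivAt_id r).sub_const y
    have h3 := ((hd (r - y)).comp r h2).mul_const (f y)
    refine h3.congr_fderiv ?_
    simp only [F']
    rw [ContinuousLinearMap.comp_id, Finset.smul_sum]
    refine Finset.sum_congr rfl fun i _ => ?_
    rw [smul_smul, mul_comm]
  have haux := hk_sum_aux (volume : Measure (Euc d)) (fun i y => g i (x - y) * f y) hint
    (fun i => (hkP i : Euc d →L[ℝ] ℝ))
  have hFi : Integrable (fun y => K (x - y) * f y) :=
    Integrable.bdd_mul (c := B) hf (hm _ hK x) (Filter.Eventually.of_forall fun y => hKB _)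
  have hbi : Integrable bound := hf.norm.const_mul _
  have key := hasFDerivAt_integral_of_dominated_of_fderiv_le (𝕜 := ℝ)
    (μ := (volume : Measure (Euc d))) (F := fun x y => K (x - y) * f y) (F' := F')
    (x₀ := x) (s := Set.univ) (bound := bound) Filter.univ_mem
    (Filter.Eventually.of_forall fun r => (hm _ hK r).mul hf.aestronglyMeasurable)
    hFi haux.1 (Filter.Eventually.of_forall fun y r _ => h_bound y r) hbi
    (Filter.Eventually.of_forall fun y r _ => h_diff y r)
  rw [← haux.2]
  exact key

lemma hkE_hasFDerivAt {d : ℕ} {f : Euc d → ℝ} (hf : Integrable f) (α : Fin d → ℕ) (h s : ℝ)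
    (hs : 0 < s) (x : Euc d) :
    HasFDerivAt (hkE f α h s)
      (∑ i, ((α i : ℝ) * hkE f (α - Pi.single i 1) (h - 1/2) s x
        - 1/2 * hkE f (α + Pi.single i 1) (h - 1/2) s x) •
      hkP i) x := by
  choose C hC0 hC using fun α : Fin d → ℕ => hkK_bdd α (h - 1/2)
  obtain ⟨B, hB0, hB⟩ := hkK_bdd α h
  have hg : ∀ i : Fin d, Continuous (fun z : Euc d =>
      (α i : ℝ) * hkK (α - Pi.single i 1) (h - 1/2) s z
        - 1/2 * hkK (α + Pi.single i 1) (h - 1/2) s z) := fun i =>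
    (continuous_const.mul (hkK_continuous _ _ _)).sub (continuous_const.mul (hkK_continuous _ _ _))
  have hb : ∀ (i : Fin d) (z : Euc d), |(α i : ℝ) * hkK (α - Pi.single i 1) (h - 1/2) s z
        - 1/2 * hkK (α + Pi.single i 1) (h - 1/2) s z| ≤
        (α i : ℝ) * (C (α - Pi.single i 1) * s ^ (h - 1/2))
        + 1/2 * (C (α + Pi.single i 1) * s ^ (h - 1/2)) := by
    intro i z
    refine (abs_sub _ _).trans (add_le_add ?_ ?_)
    · rw [abs_mul, Nat.abs_cast]
      exact mul_le_mul_of_nonneg_left (hC (α - Pi.single i 1) s hs z) (Nat.cast_nonneg _)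
    · rw [abs_mul, abs_of_pos (by norm_num : (0:ℝ) < 1/2)]
      exact mul_le_mul_of_nonneg_left (hC (α + Pi.single i 1) s hs z) (by norm_num)
  have hfd := hkK_hasFDerivAt α h s hs
  have key := hk_abstract_fderiv hf (hkK α h s)
    (fun i z => (α i : ℝ) * hkK (α - Pi.single i 1) (h - 1/2) s z
        - 1/2 * hkK (α + Pi.single i 1) (h - 1/2) s z) (hkK_continuous α h s)
    hg (B * s ^ h) (hB s hs)
    (fun i => (α i : ℝ) * (C (α - Pi.single i 1) * s ^ (h - 1/2))
        + 1/2 * (C (α + Pi.single i 1) * s ^ (h - 1/2))) hb hfd x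
  have e : ∀ i, ∫ y, ((α i : ℝ) * hkK (α - Pi.single i 1) (h - 1/2) s (x - y)
        - 1/2 * hkK (α + Pi.single i 1) (h - 1/2) s (x - y)) * f y =
      (α i : ℝ) * hkE f (α - Pi.single i 1) (h - 1/2) s x
        - 1/2 * hkE f (α + Pi.single i 1) (h - 1/2) s x := by
    intro i
    have e : (fun y => ((α i : ℝ) * hkK (α - Pi.single i 1) (h - 1/2) s (x - y)
        - 1/2 * hkK (α + Pi.single i 1) (h - 1/2) s (x - y)) * f y) = fun y =>
      (α i : ℝ) * (hkK (α - Pi.single i 1) (h - 1/2) s (x - y) * f y)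
        - 1/2 * (hkK (α + Pi.single i 1) (h - 1/2) s (x - y) * f y) := by
      funext y; ring
    have i1 := (hkE_integrable hf (α - Pi.single i 1) (h - 1/2) s hs x).const_mul (α i : ℝ)
    have i2 := (hkE_integrable hf (α + Pi.single i 1) (h - 1/2) s hs x).const_mul (1/2)
    rw [e, integral_sub i1 i2, integral_const_mul, integral_const_mul]
    rfl
  have hfun : hkE f α h s = fun x => ∫ y, hkK α h s (x - y) * f y := rfl
  rw [hfun]
  refine key.congr_fderiv ?_
  refine Finset.sum_congr rfl fun i _ => ?_
  exact congrArg (fun c : ℝ => c • (hkP i : Euc d →L[ℝ] ℝ)) (e i)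

/-- Weighted finite combinations of the basic functions. -/
inductive hkRep {d : ℕ} (f : Euc d → ℝ) (N n : ℕ) (h : ℝ) : ℝ → (ℝ → Euc d → ℝ) → Prop
  | mono (α : Fin d → ℕ) (hα : msize α ≤ n) :
      hkRep f N n h ((N : ℝ) ^ ((msize α : ℝ) / 2)) (fun s x => hkE f α h s x)
  | zero : hkRep f N n h 0 (fun _ _ => 0)
  | add {A B : ℝ} {u v : ℝ → Euc d → ℝ} : hkRep f N n h A u → hkRep f N n h B v →
      hkRep f N n h (A + B) (fun s x => u s x + v s x)
  | smul {A : ℝ} {u : ℝ → Euc d → ℝ} (c : ℝ) : hkRep f N n h A u →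
      hkRep f N n h (|c| * A) (fun s x => c * u s x)
  | le {A B : ℝ} {u : ℝ → Euc d → ℝ} : hkRep f N n h A u → A ≤ B → hkRep f N n h B u

lemma hkRep_sum {d : ℕ} {f : Euc d → ℝ} {N n : ℕ} {h : ℝ} {ι : Type*} (S : Finset ι)
    (A : ι → ℝ) (u : ι → ℝ → Euc d → ℝ) (H : ∀ i ∈ S, hkRep f N n h (A i) (u i)) :
    hkRep f N n h (∑ i ∈ S, A i) (fun s x => ∑ i ∈ S, u i s x) := by
  classical
  induction S using Finset.induction_on with
  | empty => simpa using hkRep.zero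
  | insert a S ha ih =>
    simp only [Finset.sum_insert ha]
    exact (H a (Finset.mem_insert_self _ _)).add
      (ih fun i hi => H i (Finset.mem_insert_of_mem hi))

lemma hkRep_tderiv {d : ℕ} {f : Euc d → ℝ} (hf : Integrable f) {N n : ℕ} {h : ℝ} (hN : 1 ≤ N)
    (hn : n ≤ 2 * N) (hh : |h| ≤ (1 + d) * N) {A : ℝ} {u : ℝ → Euc d → ℝ}
    (H : hkRep f N n h A u) :
    ∃ u', hkRep f N (n + 2) (h - 1) (A * ((2 * d + 2) * N)) u' ∧
      ∀ s, 0 < s → ∀ x, HasDerivAt (fun s => u s x) (u' s x) s := by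
  induction H with
  | mono α hα =>
    refine ⟨fun s x => (h - (msize α : ℝ) / 2) * hkE f α (h - 1) s x
        + ∑ i, (1/4 : ℝ) * hkE f (α + Pi.single i 2) (h - 1) s x, ?_,
        fun s hs x => hkE_hasDerivAt hf α h s hs x⟩
    refine hkRep.le (hkRep.add (hkRep.smul _ (hkRep.mono α (by omega)))
      (hkRep_sum Finset.univ _ _ fun i _ => hkRep.smul (1/4)
        (hkRep.mono (α + Pi.single i 2) (by rw [msize_add, msize_single]; omega)))) ?_
    simp only [msize_add, msize_single]
    have hN0 : (0:ℝ) < N := by exact_mod_cast hN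
    have e : (N:ℝ) ^ (((msize α + 2 : ℕ) : ℝ) / 2) = (N:ℝ) ^ ((msize α : ℝ) / 2) * N := by
      rw [← Real.rpow_add_one hN0.ne']; congr 1; push_cast; ring
    rw [e, abs_of_pos (by norm_num : (0:ℝ) < 1/4)]
    simp only [Finset.sum_const, Finset.card_univ, Fintype.card_fin, nsmul_eq_mul]
    have h1 : |h - (msize α : ℝ) / 2| ≤ (1 + d) * N + N := by
      have : (msize α : ℝ) ≤ 2 * N := by exact_mod_cast hα.trans hn
      refine (abs_sub _ _).trans (add_le_add hh ?_)
      rw [abs_of_nonneg (by positivity)]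
      linarith
    have hP : 0 ≤ (N:ℝ) ^ ((msize α : ℝ) / 2) := by positivity
    have hd : 0 ≤ (d:ℝ) := by positivity
    have := mul_le_mul_of_nonneg_right h1 hP
    have := mul_nonneg (mul_nonneg hd hP) hN0.le
    nlinarith
  | zero => exact ⟨_, by simpa using hkRep.zero, fun s hs x => hasDerivAt_const _ _⟩
  | add _ _ ih1 ih2 =>
    obtain ⟨u', h1, h2⟩ := ih1
    obtain ⟨v', h3, h4⟩ := ih2
    exact ⟨_, by rw [add_mul]; exact h1.add h3, fun s hs x => (h2 s hs x).add (h4 s hs x)⟩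
  | smul c _ ih =>
    obtain ⟨u', h1, h2⟩ := ih
    exact ⟨_, by rw [mul_assoc]; exact h1.smul c, fun s hs x => (h2 s hs x).const_mul c⟩
  | le _ hAB ih =>
    obtain ⟨u', h1, h2⟩ := ih
    exact ⟨u', h1.le (by gcongr), h2⟩

lemma hkRep_pd {d : ℕ} {f : Euc d → ℝ} (hf : Integrable f) {N n : ℕ} {h : ℝ} (hN : 1 ≤ N)
    (hn : n ≤ 2 * N) {A : ℝ} {u : ℝ → Euc d → ℝ} (i : Fin d)
    (H : hkRep f N n h A u) :
    ∃ u', hkRep f N (n + 1) (h - 1/2) (A * (3 * (N:ℝ) ^ (1/2 : ℝ))) u' ∧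
      ∀ s, 0 < s → ∀ x, DifferentiableAt ℝ (u s) x ∧ pd i (u s) x = u' s x := by
  induction H with
  | mono α hα =>
    refine ⟨fun s x => (α i : ℝ) * hkE f (α - Pi.single i 1) (h - 1/2) s x
        + (-(1/2)) * hkE f (α + Pi.single i 1) (h - 1/2) s x, ?_, fun s hs x => ?_⟩
    · refine hkRep.le (hkRep.add (hkRep.smul _ (hkRep.mono _ (by have := msize_sub_le α i; omega)))
        (hkRep.smul _ 
        (hkRep.mono (α + Pi.single i 1) (by rw [msize_add, msize_single]; omega)))) ?_
      simp only [msize_add, msize_single]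
      have hN0 : (0:ℝ) < N := by exact_mod_cast hN
      have e : (N:ℝ) ^ (((msize α + 1 : ℕ) : ℝ) / 2) =
          (N:ℝ) ^ ((msize α : ℝ) / 2) * (N:ℝ) ^ (1/2 : ℝ) := by
        rw [← Real.rpow_add hN0]; congr 1; push_cast; ring
      have e2 : |(α i : ℝ)| * (N:ℝ) ^ ((msize (α - Pi.single i 1) : ℝ) / 2) ≤
          2 * ((N:ℝ) ^ ((msize α : ℝ) / 2) * (N:ℝ) ^ (1/2 : ℝ)) := by
        by_cases hi : α i = 0
        · rw [hi]; simp; positivity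
        · have h3 := msize_sub α i hi
          have h4 : (α i : ℝ) ≤ 2 * N := by exact_mod_cast (le_msize α i).trans (hα.trans hn)
          have h5 : (N:ℝ) * (N:ℝ) ^ ((msize (α - Pi.single i 1) : ℝ) / 2) =
              (N:ℝ) ^ ((msize α : ℝ) / 2) * (N:ℝ) ^ (1/2 : ℝ) := by
            rw [← Real.rpow_add hN0, mul_comm, ← Real.rpow_add_one hN0.ne', ← h3]
            congr 1; push_cast; ring
          rw [← h5, abs_of_nonneg (by positivity), ← mul_assoc]
          gcongr
      rw [e, abs_neg, abs_of_pos (by norm_num : (0:ℝ) < 1/2)]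
      have : 0 ≤ (N:ℝ) ^ ((msize α : ℝ) / 2) * (N:ℝ) ^ (1/2 : ℝ) := by positivity
      nlinarith
    · have := hkE_hasFDerivAt hf α h s hs x
      refine ⟨this.differentiableAt, ?_⟩
      unfold pd
      change fderiv ℝ (hkE f α h s) x _ = _
      rw [this.fderiv]
      simp only [_root_.sum_apply, _root_.smul_apply, hkP_apply,
        smul_eq_mul]
      rw [Finset.sum_eq_single i]
      · simp; ring
      · intro b _ hb; simp [hb]
      · simp
  | zero => exact ⟨_, by simpa using hkRep.zero, fun s hs x => ⟨by fun_prop, by simp [pd]⟩⟩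
  | add _ _ ih1 ih2 =>
    obtain ⟨u', h1, h2⟩ := ih1
    obtain ⟨v', h3, h4⟩ := ih2
    refine ⟨_, by rw [add_mul]; exact h1.add h3, fun s hs x => ?_⟩
    obtain ⟨a1, a2⟩ := h2 s hs x
    obtain ⟨a3, a4⟩ := h4 s hs x
    refine ⟨a1.add a3, ?_⟩
    rw [← a2, ← a4]
    unfold pd
    rw [fderiv_fun_add a1 a3]; rfl
  | smul c _ ih =>
    obtain ⟨u', h1, h2⟩ := ih
    refine ⟨_, by rw [mul_assoc]; exact h1.smul c, fun s hs x => ?_⟩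
    obtain ⟨a1, a2⟩ := h2 s hs x
    refine ⟨a1.const_mul c, ?_⟩
    rw [← a2]
    unfold pd
    rw [fderiv_const_mul a1]; rfl
  | le _ hAB ih =>
    obtain ⟨u', h1, h2⟩ := ih
    exact ⟨u', h1.le (by gcongr), h2⟩

lemma hkRep_nonneg {d : ℕ} {f : Euc d → ℝ} {N n : ℕ} {h : ℝ} {A : ℝ} {u : ℝ → Euc d → ℝ}
    (H : hkRep f N n h A u) : 0 ≤ A := by
  induction H with
  | mono α hα => positivity
  | zero => exact le_rfl
  | add _ _ h1 h2 => exact add_nonneg h1 h2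
  | smul c _ h1 => positivity
  | le _ h1 h2 => exact h2.trans h1

/-- Gaussian majorant. -/
def hkW {d : ℕ} (f : Euc d → ℝ) (t : ℝ) (x : Euc d) : ℝ≥0∞ :=
  ∫⁻ y, ENNReal.ofReal (Real.exp (-‖x - y‖ ^ 2 / (8 * t))) * ‖f y‖ₑ

lemma hkRep_bound {d : ℕ} {f : Euc d → ℝ} {N n : ℕ} {h : ℝ} (hN : 1 ≤ N)
    (hn : n ≤ 2 * N) {A : ℝ} {u : ℝ → Euc d → ℝ} (H : hkRep f N n h A u) (t : ℝ) (ht : 0 < t)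
    (x : Euc d) : ‖u t x‖ₑ ≤ ENNReal.ofReal (A * (8 ^ N * t ^ h)) * hkW f t x := by
  have hX : 0 ≤ (8:ℝ) ^ N * t ^ h := by positivity
  induction H with
  | mono α hα =>
    unfold hkE hkW
    rw [← lintegral_const_mul' _ _ ENNReal.ofReal_ne_top]
    refine (enorm_integral_le_lintegral_enorm _).trans (lintegral_mono fun y => ?_)
    rw [enorm_mul, ← mul_assoc, ← ENNReal.ofReal_mul (by positivity)]
    gcongr
    rw [Real.enorm_eq_ofReal_abs]
    apply ENNReal.ofReal_le_ofReal
    refine (hkK_bound α h t ht (x - y) N hN (hα.trans hn)).trans (le_of_eq ?_)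
    ring
  | zero => simp
  | add H1 H2 h1 h2 =>
    rw [add_mul, ENNReal.ofReal_add (mul_nonneg (hkRep_nonneg H1) hX)
      (mul_nonneg (hkRep_nonneg H2) hX), add_mul]
    exact (enorm_add_le _ _).trans (add_le_add h1 h2)
  | smul c H1 h1 =>
    rw [mul_assoc, ENNReal.ofReal_mul (abs_nonneg c), mul_assoc, enorm_mul,
      Real.enorm_eq_ofReal_abs c]
    gcongr
  | le _ hAB h1 =>
    refine h1.trans ?_
    gcongr

lemma hkW_le {d : ℕ} (f : Euc d → ℝ) (t : ℝ) (ht : 0 < t) (x : Euc d) :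
    hkW f t x ≤ eLpNorm f 1 volume := by
  rw [eLpNorm_one_eq_lintegral_enorm]
  refine lintegral_mono fun y => ?_
  refine mul_le_of_le_one_left zero_le ?_
  rw [ENNReal.ofReal_le_one, Real.exp_le_one_iff]
  apply div_nonpos_of_nonpos_of_nonneg
  · nlinarith [norm_nonneg (x - y)]
  · positivity

lemma hk_gauss {d : ℕ} (t : ℝ) (ht : 0 < t) :
    ∫⁻ x : Euc d, ENNReal.ofReal (Real.exp (-‖x‖ ^ 2 / (8 * t))) =
      ENNReal.ofReal ((8 * Real.pi * t) ^ ((d : ℝ) / 2)) := by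
  have hb : 0 < 1 / (8 * t) := by positivity
  have e : (fun x : Euc d => Real.exp (-‖x‖ ^ 2 / (8 * t))) =
      fun x : Euc d => Real.exp (-(1 / (8 * t)) * ‖x‖ ^ 2) := by
    funext x; congr 1; ring
  have h1 := GaussianFourier.integral_rexp_neg_mul_sq_norm (V := Euc d) hb
  rw [← e] at h1
  have hpos : 0 < (Real.pi / (1 / (8 * t))) ^ (Module.finrank ℝ (Euc d) / 2 : ℝ) := by positivity
  have hint : Integrable (fun x : Euc d => Real.exp (-‖x‖ ^ 2 / (8 * t))) := by
    by_contra hc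
    rw [integral_undef hc] at h1
    exact hpos.ne h1
  rw [← ofReal_integral_eq_lintegral_ofReal hint (Filter.Eventually.of_forall fun x =>
    (Real.exp_pos _).le), h1]
  congr 1
  rw [finrank_euclideanSpace_fin]
  congr 1
  field_simp

lemma hkW_lintegral {d : ℕ} {f : Euc d → ℝ} (hf : Integrable f) (t : ℝ) (ht : 0 < t) :
    ∫⁻ x, hkW f t x = ENNReal.ofReal ((8 * Real.pi * t) ^ ((d : ℝ) / 2)) * eLpNorm f 1 volume := by
  unfold hkW
  rw [lintegral_lintegral_swap]
  · have : ∀ y : Euc d, ∫⁻ x : Euc d,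
        ENNReal.ofReal (Real.exp (-‖x - y‖ ^ 2 / (8 * t))) * ‖f y‖ₑ =
        ENNReal.ofReal ((8 * Real.pi * t) ^ ((d : ℝ) / 2)) * ‖f y‖ₑ := by
      intro y
      rw [lintegral_mul_const' _ _ enorm_ne_top]
      rw [lintegral_sub_right_eq_self
        (fun x : Euc d => ENNReal.ofReal (Real.exp (-‖x‖ ^ 2 / (8 * t)))) y, hk_gauss t ht]
    simp only [this]
    rw [lintegral_const_mul' _ _ ENNReal.ofReal_ne_top, eLpNorm_one_eq_lintegral_enorm]
  · have h1 : AEMeasurable (fun z : Euc d × Euc d =>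
        ENNReal.ofReal (Real.exp (-‖z.1 - z.2‖ ^ 2 / (8 * t)))) (volume.prod volume) :=
      (ENNReal.continuous_ofReal.comp (by fun_prop)).aemeasurable
    have h2 : AEMeasurable (fun y => ‖f y‖ₑ) (volume : Measure (Euc d)) := hf.1.enorm
    have h3 : AEMeasurable (fun z : Euc d × Euc d => ‖f z.2‖ₑ) (volume.prod volume) := h2.comp_snd
    exact h1.mul h3

lemma hk_interp {Ω : Type*} [MeasurableSpace Ω] (μ : Measure Ω) (v : Ω → ℝ) (W : Ω → ℝ≥0∞)
    (c I J : ℝ≥0∞) (hc : c ≠ ⊤) (hI : I ≠ ⊤) (hv : ∀ x, ‖v x‖ₑ ≤ c * W x) (hW : ∀ x, W x ≤ I)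
    (hJ : ∫⁻ x, W x ∂μ ≤ J * I) (q : ℝ≥0∞) (hq : 1 ≤ q) :
    eLpNorm v q μ ≤ c * J ^ (q⁻¹.toReal) * I := by
  by_cases hqt : q = ⊤
  · subst hqt
    simp only [ENNReal.inv_top, ENNReal.toReal_zero, ENNReal.rpow_zero, mul_one,
      eLpNorm_exponent_top]
    refine essSup_le_of_ae_le _ (Filter.Eventually.of_forall fun x => ?_)
    exact (hv x).trans (mul_le_mul' le_rfl (hW x))
  · have hq0 : q ≠ 0 := (zero_lt_one.trans_le hq).ne'
    have hr : 1 ≤ q.toReal := by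
      rw [← ENNReal.toReal_one]; exact ENNReal.toReal_mono hqt hq
    rw [eLpNorm_eq_lintegral_rpow_enorm_toReal hq0 hqt, ENNReal.toReal_inv, one_div]
    set r := q.toReal with hr'
    have hr0 : 0 < r := by linarith
    have h1 : ∫⁻ x, ‖v x‖ₑ ^ r ∂μ ≤ c ^ r * J * I ^ r := by
      calc ∫⁻ x, ‖v x‖ₑ ^ r ∂μ ≤ ∫⁻ x, (c ^ r * I ^ (r - 1)) * W x ∂μ := by
            refine lintegral_mono fun x => ?_
            calc ‖v x‖ₑ ^ r ≤ (c * W x) ^ r := by gcongr; exact hv x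
              _ = c ^ r * (W x ^ (r - 1) * W x) := by
                  rw [ENNReal.mul_rpow_of_nonneg _ _ hr0.le]
                  congr 1
                  conv_lhs => rw [show r = (r - 1) + 1 by ring]
                  rw [ENNReal.rpow_add_of_nonneg _ _ (by linarith) zero_le_one, ENNReal.rpow_one]
              _ ≤ _ := by
                  rw [← mul_assoc]
                  have : 0 ≤ r - 1 := by linarith
                  gcongr
                  exact hW x
        _ = (c ^ r * I ^ (r - 1)) * ∫⁻ x, W x ∂μ := by
            refine lintegral_const_mul' _ _ (ENNReal.mul_ne_top ?_ ?_)
            · exact ENNReal.rpow_ne_top_of_nonneg hr0.le hc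
            · exact ENNReal.rpow_ne_top_of_nonneg (by linarith) hI
        _ ≤ (c ^ r * I ^ (r - 1)) * (J * I) := by gcongr
        _ = _ := by
            have : I ^ r = I ^ (r - 1) * I := by
              conv_lhs => rw [show r = (r - 1) + 1 by ring]
              rw [ENNReal.rpow_add_of_nonneg _ _ (by linarith) zero_le_one, ENNReal.rpow_one]
            rw [this]; ring
    calc (∫⁻ x, ‖v x‖ₑ ^ r ∂μ) ^ r⁻¹ ≤ (c ^ r * J * I ^ r) ^ r⁻¹ := by gcongr
      _ = _ := by
        rw [ENNReal.mul_rpow_of_nonneg _ _ (by positivity),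
          ENNReal.mul_rpow_of_nonneg _ _ (by positivity), ← ENNReal.rpow_mul, ← ENNReal.rpow_mul,
          mul_inv_cancel₀ hr0.ne', ENNReal.rpow_one, ENNReal.rpow_one]

lemma hk_tder {d : ℕ} {f : Euc d → ℝ} (hf : Integrable f) {N k m : ℕ} (hN : 1 ≤ N) (hk : k ≤ N)
    (hm : m ≤ N) (j : ℕ) (hj : j ≤ k) :
    ∃ u, hkRep f N (2 * j) ((m : ℝ) - (d : ℝ) / 2 - j) (((2 * d + 2) * N : ℝ) ^ j) u ∧
      ∀ s, 0 < s → ∀ x,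
        iteratedDeriv j (fun s => s ^ m * conv (heatKernel d s) f x) s = u s x := by
  have hN0 : (1:ℝ) ≤ N := by exact_mod_cast hN
  induction j with
  | zero =>
    refine ⟨_, ((hkRep.mono (0 : Fin d → ℕ) (by simp [msize])).smul
      ((4 * Real.pi) ^ (-(d : ℝ) / 2))).le ?_, fun s hs x => ?_⟩
    · simp only [msize, Pi.zero_apply, Finset.sum_const_zero, Nat.cast_zero, zero_div,
        Real.rpow_zero, mul_one, pow_zero]
      rw [abs_of_nonneg (by positivity)]
      apply Real.rpow_le_one_of_one_le_of_nonpos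
      · nlinarith [Real.pi_gt_three]
      · have : 0 ≤ (d:ℝ) := by positivity
        linarith
    · simp only [iteratedDeriv_zero, conv, hkE, heatKernel, hkK, hkMon, msize]
      rw [← integral_const_mul, ← integral_const_mul]
      congr 1
      funext y
      simp only [Pi.zero_apply, pow_zero, Finset.prod_const_one, Finset.sum_const_zero,
        Nat.cast_zero, zero_div, sub_zero, one_mul]
      rw [Real.mul_rpow (by positivity) hs.le, Real.rpow_sub hs, Real.rpow_natCast, neg_div,
        Real.rpow_neg hs.le]
      ring
  | succ j ih =>
    obtain ⟨u, h1, h2⟩ := ih (by omega)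
    have hh : |(m : ℝ) - (d : ℝ) / 2 - j| ≤ (1 + d) * N := by
      have a1 : (m:ℝ) ≤ N := by exact_mod_cast hm
      have a2 : (j:ℝ) ≤ N := by exact_mod_cast (by omega : j ≤ N)
      have a3 : (0:ℝ) ≤ d := by positivity
      have a4 : (0:ℝ) ≤ m := by positivity
      have a5 : (0:ℝ) ≤ j := by positivity
      rw [abs_le]; constructor <;> nlinarith
    obtain ⟨u', h3, h4⟩ := hkRep_tderiv hf hN (by omega) hh h1
    refine ⟨u', ?_, fun s hs x => ?_⟩
    · have e : (m : ℝ) - (d : ℝ) / 2 - ((j + 1 : ℕ) : ℝ) = (m : ℝ) - (d : ℝ) / 2 - j - 1 := by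
        push_cast; ring
      rw [e, pow_succ]
      exact h3
    · rw [iteratedDeriv_succ, ← (h4 s hs x).deriv]
      apply Filter.EventuallyEq.deriv_eq
      filter_upwards [lt_mem_nhds hs] with r hr
      exact h2 r hr x

lemma hk_pd_iter {d : ℕ} {f : Euc d → ℝ} (hf : Integrable f) {N n : ℕ} {h : ℝ} (hN : 1 ≤ N)
    {A : ℝ} {u : ℝ → Euc d → ℝ} (H : hkRep f N n h A u) (t : ℝ) (ht : 0 < t) (i : Fin d) (j : ℕ)
    (hn : n + j ≤ 2 * N) :
    ∃ v, hkRep f N (n + j) (h - (j : ℝ) / 2) (A * (3 * (N:ℝ) ^ (1/2 : ℝ)) ^ j) v ∧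
      (pd i)^[j] (u t) = v t := by
  induction j with
  | zero => exact ⟨u, by simpa using H, rfl⟩
  | succ j ih =>
    obtain ⟨v, h1, h2⟩ := ih (by omega)
    obtain ⟨v', h3, h4⟩ := hkRep_pd hf hN (by omega) i h1
    refine ⟨v', ?_, ?_⟩
    · have e : h - ((j + 1 : ℕ) : ℝ) / 2 = h - (j : ℝ) / 2 - 1 / 2 := by
        push_cast; ring
      rw [e, pow_succ, ← mul_assoc]
      exact h3
    · rw [Function.iterate_succ_apply', h2]
      funext x
      exact (h4 t ht x).2

lemma hk_mder {d : ℕ} {f : Euc d → ℝ} (hf : Integrable f) {N n : ℕ} {h : ℝ} (hN : 1 ≤ N)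
    {A : ℝ} {u : ℝ → Euc d → ℝ} (H : hkRep f N n h A u) (t : ℝ) (ht : 0 < t) (β : Fin d → ℕ)
    (l : List (Fin d)) (hn : n + (l.map β).sum ≤ 2 * N) :
    ∃ v, hkRep f N (n + (l.map β).sum) (h - ((l.map β).sum : ℝ) / 2)
      (A * (3 * (N:ℝ) ^ (1/2 : ℝ)) ^ (l.map β).sum) v ∧
      l.foldr (fun i g => (pd i)^[β i] g) (u t) = v t := by
  induction l with
  | nil => exact ⟨u, by simpa using H, rfl⟩
  | cons i l ih =>
    simp only [List.map_cons, List.sum_cons] at hn ⊢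
    obtain ⟨v, h1, h2⟩ := ih (by omega)
    obtain ⟨v', h3, h4⟩ := hk_pd_iter hf hN h1 t ht i (β i) (by omega)
    refine ⟨v', ?_, ?_⟩
    · convert h3 using 1
      · ring
      · push_cast; ring
      · rw [pow_add]; ring
    · rw [List.foldr_cons, h2, h4]

theorem heatKernel_conv_spacetime_deriv_Lq_bound (d : ℕ) (hd : 1 ≤ d) :
    ∃ M₀ : ℝ, 0 < M₀ ∧
      ∀ (f : Euc d → ℝ), MemLp f 1 volume →
        ∀ (β : Fin d → ℕ) (k m : ℕ), 0 < msize β + k → m ≤ k →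
          ∀ (q : ℝ≥0∞), 1 ≤ q → ∀ t : ℝ, 0 < t →
            eLpNorm
              (mderiv β (tderiv k (fun s x => s ^ m * conv (heatKernel d s) f x) t)) q volume ≤
              ENNReal.ofReal
                (M₀ ^ ((msize β : ℝ) / 2 + (k : ℝ)) *
                  ((msize β : ℝ) + (k : ℝ)) ^
                    ((msize β : ℝ) / 2 + (k : ℝ) + ((d : ℝ) / 2) * (1 - q⁻¹.toReal)) *
                  t ^ (-(((msize β : ℝ) + 2 * ((k : ℝ) - (m : ℝ))) / 2) -
                        ((d : ℝ) / 2) * (1 - q⁻¹.toReal)) *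
                  (eLpNorm f 1 volume).toReal) := by
  refine ⟨576 * (d + 1) * (8 * Real.pi) ^ d, by positivity, ?_⟩
  intro f hfL β k m hβk hmk q hq t ht
  have hf : Integrable f := memLp_one_iff_integrable.1 hfL
  obtain ⟨N, hN⟩ : ∃ N, N = msize β + k := ⟨_, rfl⟩
  have hN1 : 1 ≤ N := by omega
  obtain ⟨u, hu, hu2⟩ := hk_tder hf (N := N) (k := k) (m := m) hN1 (by omega) (by omega) k le_rfl
  have hl : ((List.finRange d).map β).sum = msize β := by
    unfold msize; rw [Fin.sum_univ_def]
  obtain ⟨v, hv, hv2⟩ := hk_mder hf hN1 hu t ht β (List.finRange d) (by rw [hl]; omega)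
  rw [hl] at hv
  have e1 : mderiv β (tderiv k (fun s x => s ^ m * conv (heatKernel d s) f x) t) = v t := by
    unfold mderiv
    rw [← hv2]
    congr 1
    funext x
    exact hu2 t ht x
  rw [e1]
  set I := eLpNorm f 1 volume with hI
  have hIt : I ≠ ⊤ := hfL.2.ne
  refine (hk_interp volume (v t) (hkW f t) _ I _ ENNReal.ofReal_ne_top hIt
    (fun x => hkRep_bound hN1 (by omega) hv t ht x) (hkW_le f t ht)
    (hkW_lintegral hf t ht).le q hq).trans ?_
  have hp0 : 0 ≤ q⁻¹.toReal := ENNReal.toReal_nonneg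
  have hp1 : q⁻¹.toReal ≤ 1 := by
    rw [← ENNReal.toReal_one]
    exact ENNReal.toReal_mono ENNReal.one_ne_top (ENNReal.inv_le_one.2 hq)
  set p := q⁻¹.toReal with hp
  rw [ENNReal.ofReal_rpow_of_nonneg (by positivity) hp0]
  have hA := hkRep_nonneg hv
  conv_lhs => rw [← ENNReal.ofReal_toReal hIt]
  rw [← ENNReal.ofReal_mul (by positivity), ← ENNReal.ofReal_mul (by positivity)]
  apply ENNReal.ofReal_le_ofReal
  refine mul_le_mul_of_nonneg_right ?_ ENNReal.toReal_nonneg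
  have hNr : (msize β : ℝ) + (k : ℝ) = N := by rw [hN]; push_cast; ring
  rw [hNr]
  have hN0 : (1:ℝ) ≤ N := by exact_mod_cast hN1
  have hNpos : (0:ℝ) < N := by linarith
  have hπ := Real.pi_gt_three
  set b : ℕ := msize β with hb
  set E : ℝ := (b : ℝ) / 2 + k with hE
  have hE2 : 1 / 2 ≤ E := by
    have h1 : (1:ℝ) ≤ (b:ℝ) + k := by rw [hNr]; exact hN0
    have h2 : (0:ℝ) ≤ k := by positivity
    rw [hE]; linarith
  have hd0 : (0:ℝ) ≤ d := by positivity
  -- the pieces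
  have c1 : ((2 * d + 2) * N : ℝ) ^ k * (3 * (N:ℝ) ^ (1/2 : ℝ)) ^ b * 8 ^ N ≤
      (576 * (d + 1) : ℝ) ^ E * (N:ℝ) ^ E := by
    have a1 : (N:ℝ) ^ E = (N:ℝ) ^ k * ((N:ℝ) ^ (1/2 : ℝ)) ^ b := by
      rw [hE, add_comm, Real.rpow_add hNpos, Real.rpow_natCast, ← Real.rpow_natCast _ b,
        ← Real.rpow_mul hNpos.le]
      congr 2; ring
    have a2 : (576 * (d + 1) : ℝ) ^ E =
        (576 * (d + 1) : ℝ) ^ k * ((576 * (d + 1) : ℝ) ^ (1/2 : ℝ)) ^ b := by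
      have : (0:ℝ) < 576 * (d + 1) := by positivity
      rw [hE, add_comm ((b : ℝ) / 2), Real.rpow_add this, Real.rpow_natCast, ← Real.rpow_natCast _ b,
        ← Real.rpow_mul this.le]
      congr 2; ring
    have a3 : (24:ℝ) ≤ (576 * (d + 1) : ℝ) ^ (1/2 : ℝ) := by
      rw [← Real.sqrt_eq_rpow]
      apply Real.le_sqrt_of_sq_le
      nlinarith
    rw [a1, a2, hN, pow_add, mul_pow, mul_pow, ← hN]
    calc (2 * (d:ℝ) + 2) ^ k * (N:ℝ) ^ k * (3 ^ b * ((N:ℝ) ^ (1/2 : ℝ)) ^ b) * (8 ^ b * 8 ^ k)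
        = ((16 * (d + 1) : ℝ) ^ k * 24 ^ b) * ((N:ℝ) ^ k * ((N:ℝ) ^ (1/2 : ℝ)) ^ b) := by
          rw [show (16 * ((d:ℝ) + 1)) = (2 * (d:ℝ) + 2) * 8 by ring,
            show (24:ℝ) = 3 * 8 by norm_num, mul_pow, mul_pow]
          ring
      _ ≤ _ := by
          gcongr
          norm_num
  have c2 : ((8 * Real.pi * t) ^ ((d:ℝ) / 2)) ^ p ≤
      ((8 * Real.pi) ^ d) ^ E * t ^ ((d:ℝ) / 2 * p) := by
    rw [← Real.rpow_mul (by positivity), Real.mul_rpow (by positivity) ht.le]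
    gcongr
    rw [← Real.rpow_natCast, ← Real.rpow_mul (by positivity)]
    apply Real.rpow_le_rpow_of_exponent_le
    · nlinarith
    · nlinarith [mul_nonneg hd0 (sub_nonneg.2 hp1), mul_nonneg hd0 (sub_nonneg.2 hE2)]
  have c3 : (N:ℝ) ^ E ≤ (N:ℝ) ^ (E + (d:ℝ) / 2 * (1 - p)) := by
    apply Real.rpow_le_rpow_of_exponent_le hN0
    have : 0 ≤ (d:ℝ) / 2 * (1 - p) := mul_nonneg (by positivity) (by linarith)
    linarith
  have c4 : t ^ ((m:ℝ) - (d:ℝ) / 2 - k - (b:ℝ) / 2) * t ^ ((d:ℝ) / 2 * p) =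
      t ^ (-(((b:ℝ) + 2 * ((k : ℝ) - (m : ℝ))) / 2) - ((d : ℝ) / 2) * (1 - p)) := by
    rw [← Real.rpow_add ht]; congr 1; ring
  have c5 : (576 * (d + 1) * (8 * Real.pi) ^ d : ℝ) ^ E =
      (576 * (d + 1) : ℝ) ^ E * ((8 * Real.pi) ^ d) ^ E :=
    Real.mul_rpow (by positivity) (by positivity)
  have c6 : ((2 * d + 2) * N : ℝ) ^ k * (3 * (N:ℝ) ^ (1/2 : ℝ)) ^ b * 8 ^ N ≤
      (576 * (d + 1) : ℝ) ^ E * (N:ℝ) ^ (E + (d:ℝ) / 2 * (1 - p)) := c1.trans (by gcongr)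
  rw [← c4, c5]
  calc _ = (((2 * d + 2) * N : ℝ) ^ k * (3 * (N:ℝ) ^ (1/2 : ℝ)) ^ b * 8 ^ N) *
        t ^ ((m:ℝ) - (d:ℝ) / 2 - k - (b:ℝ) / 2) * ((8 * Real.pi * t) ^ ((d:ℝ) / 2)) ^ p := by ring
    _ ≤ ((576 * (d + 1) : ℝ) ^ E * (N:ℝ) ^ (E + (d:ℝ) / 2 * (1 - p))) *
        t ^ ((m:ℝ) - (d:ℝ) / 2 - k - (b:ℝ) / 2) *
        (((8 * Real.pi) ^ d) ^ E * t ^ ((d:ℝ) / 2 * p)) := by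
      refine mul_le_mul (mul_le_mul_of_nonneg_right c6 (by positivity)) c2 (by positivity)
        (by positivity)
    _ = _ := by ring

end
end
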